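/- arXiv:1101.4715 — 2 statements merged into one kernel-verified Lean document; each statement's English description precedes it below -/
import Mathlib

section
/- Let G be a finite abelian group and let p be the smallest prime divisor of |G|. Assume p = 2 and |G| ≥ 36. Let A ⊆ G \ {0} be a subset of cardinality cr(G) − 1 such that Σ(A) ≠ G. Then there exists a subgroup H of G of order |G|/2 such that A = H \ {0}. -/
open Finset

/-- The set of all nonempty subset sums of a finite set `A`. -/
def nss {G : Type*} [AddCommGroup G] [DecidableEq G] (A : Finset G) : Finset G :=
  (A.powerset.erase ∅).image fun B => B.sum id

/-- The critical number of a finite abelian group `G`: the least positive integer `ℓ`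
such that every subset of `G \ {0}` of cardinality at least `ℓ` spans `G`. -/
noncomputable def cr (G : Type*) [AddCommGroup G] [Fintype G] [DecidableEq G] : ℕ :=
  sInf {ℓ : ℕ | 0 < ℓ ∧ ∀ A : Finset G, (0 : G) ∉ A → ℓ ≤ A.card → nss A = Finset.univ}

section

variable {G : Type*} [AddCommGroup G]

theorem range_two_nsmul_ne_top [Fintype G] (heven : 2 ∣ Fintype.card G) :
    (nsmulAddMonoidHom (α := G) 2).range ≠ ⊤ := by
  have : Fact (Nat.Prime 2) := ⟨Nat.prime_two⟩
  rw [Ne, AddMonoidHom.range_eq_top]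
  intro hs
  have hi := Finite.injective_iff_surjective.2 hs
  obtain ⟨x, hx⟩ := exists_prime_addOrderOf_dvd_card 2 heven
  have h2 : (2 : ℕ) • x = 0 := by rw [← hx]; exact addOrderOf_nsmul_eq_zero x
  have : x = 0 := hi (by simpa using h2)
  simp [this] at hx

theorem card_le_half_of_ne_top [Fintype G] (H : AddSubgroup G) (hH : H ≠ ⊤) :
    2 * Nat.card H ≤ Fintype.card G := by
  have h1 := H.card_mul_index
  have h2 : H.index ≠ 1 := fun h => hH (AddSubgroup.index_eq_one.1 h)
  have h3 : H.index ≠ 0 := AddSubgroup.index_ne_zero_of_finite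
  rw [Nat.card_eq_fintype_card (α := G)] at h1
  have : 2 ≤ H.index := by omega
  nlinarith

theorem exists_index_eq_two [Fintype G] (heven : 2 ∣ Fintype.card G) :
    ∃ H : AddSubgroup G, H.index = 2 := by
  obtain ⟨H, hH, hle⟩ := (eq_top_or_exists_le_coatom
    (nsmulAddMonoidHom (α := G) 2).range).resolve_left (range_two_nsmul_ne_top heven)
  have hdbl : ∀ x : G, (2 : ℕ) • x ∈ H := fun x => hle ⟨x, rfl⟩
  refine ⟨H, ?_⟩
  obtain ⟨a, ha⟩ : ∃ a, a ∉ H := by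
    by_contra! h
    exact hH.1 (eq_top_iff.2 fun x _ => h x)
  rw [AddSubgroup.index_eq_two_iff]
  refine ⟨a, fun b => ?_⟩
  by_cases hb : b ∈ H
  · exact Or.inr ⟨hb, fun h => ha (by simpa using H.sub_mem h hb)⟩
  refine Or.inl ⟨?_, hb⟩
  have htop : H ⊔ AddSubgroup.zmultiples a = ⊤ := by
    refine hH.2 _ (lt_of_le_of_ne le_sup_left fun h => ha ?_)
    rw [h]
    exact (le_sup_right : AddSubgroup.zmultiples a ≤ _) (AddSubgroup.mem_zmultiples a)
  have hbt : b ∈ H ⊔ AddSubgroup.zmultiples a := htop ▸ AddSubgroup.mem_top b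
  obtain ⟨y, hy, z, hz, rfl⟩ := AddSubgroup.mem_sup.1 hbt
  obtain ⟨m, rfl⟩ := AddSubgroup.mem_zmultiples_iff.1 hz
  rcases Int.even_or_odd' m with ⟨k, rfl | rfl⟩
  · refine absurd (H.add_mem hy ?_) hb
    rw [show (2 * k) • a = (2 : ℕ) • (k • a) by
      rw [mul_comm, mul_smul, two_nsmul, two_smul, smul_add]]
    exact hdbl _
  · rw [show y + (2 * k + 1) • a + a = y + (2 : ℕ) • ((k + 1) • a) by
      rw [two_nsmul, ← add_smul, add_assoc]; nth_rewrite 2 [← one_smul ℤ a]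
      rw [← add_smul]; congr 2; ring]
    exact H.add_mem hy (hdbl _)

variable [DecidableEq G]

theorem mem_nss {A : Finset G} {g : G} :
    g ∈ nss A ↔ ∃ B ⊆ A, B.Nonempty ∧ ∑ x ∈ B, x = g := by
  simp only [nss, mem_image, mem_erase, mem_powerset, id, Finset.nonempty_iff_ne_empty]
  constructor
  · rintro ⟨B, ⟨h1, h2⟩, h3⟩; exact ⟨B, h2, h1, h3⟩
  · rintro ⟨B, h2, h1, h3⟩; exact ⟨B, ⟨h1, h2⟩, h3⟩

/-- If every nonzero difference of elements of `C` is represented more than `#C / 2` times, then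
`C` lies in a subgroup of order less than `2 * #C`. -/
theorem exists_addSubgroup_of_popular_differences [Fintype G] (C : Finset G) (h0 : (0 : G) ∈ C)
    (h : ∀ x ∈ C, ∀ y ∈ C, x ≠ y → #C < 2 * #{p ∈ C | p + (x - y) ∈ C}) :
    ∃ H : AddSubgroup G, Nat.card H < 2 * #C ∧ ∀ x ∈ C, x ∈ H := by
  have hc : 0 < #C := card_pos.2 ⟨0, h0⟩
  have hz : #C < 2 * #{p ∈ C | p + 0 ∈ C} := by
    have : {p ∈ C | p + 0 ∈ C} = C := by ext; simp
    rw [this]; omega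
  have hd : ∀ x ∈ C, ∀ y ∈ C, #C < 2 * #{p ∈ C | p + (x - y) ∈ C} := by
    intro x hx y hy
    by_cases hxy : x = y
    · simpa [hxy] using hz
    · exact h x hx y hy hxy
  have hneg : ∀ d : G, #{p ∈ C | p + -d ∈ C} = #{p ∈ C | p + d ∈ C} := by
    intro d
    refine card_bij' (fun p _ => p + -d) (fun p _ => p + d) ?_ ?_ ?_ ?_ <;> simp +contextual
  let H : AddSubgroup G :=
    { carrier := {d | #C < 2 * #{p ∈ C | p + d ∈ C}}
      zero_mem' := hz
      neg_mem' := by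
        intro d hd
        simpa only [Set.mem_ofPred_eq, hneg] using hd
      add_mem' := by
        intro d d' h1 h2
        simp only [Set.mem_ofPred_eq] at h1 h2
        rw [← hneg] at h1
        have : ({p ∈ C | p + -d ∈ C} ∩ {p ∈ C | p + d' ∈ C}).Nonempty := by
          rw [← card_pos]
          have h3 := card_union_add_card_inter {p ∈ C | p + -d ∈ C} {p ∈ C | p + d' ∈ C}
          have h4 : #({p ∈ C | p + -d ∈ C} ∪ {p ∈ C | p + d' ∈ C}) ≤ #C :=
            card_le_card (union_subset (filter_subset _ _) (filter_subset _ _))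
          omega
        obtain ⟨p, hp⟩ := this
        simp only [mem_inter, mem_filter] at hp
        have := hd _ hp.2.2 _ hp.1.2
        rwa [show p + d' - (p + -d) = d + d' by abel] at this }
  refine ⟨H, ?_, fun x hx => ?_⟩
  · classical
    have h1 : ∑ d ∈ univ.filter (· ∈ H), #{p ∈ C | p + d ∈ C} ≤ #C * #C := by
      simp only [card_filter]
      rw [sum_comm, ← smul_eq_mul]
      refine sum_le_card_nsmul _ _ _ fun p _ => ?_
      rw [← card_filter]
      refine card_le_card_of_injOn (fun d => p + d) ?_ ?_
      · intro d hd
        simp only [coe_filter, Set.mem_ofPred_eq, mem_filter] at hd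
        exact hd.2
      · intro d _ d' _ hdd; simpa using hdd
    have h2 : ∑ d ∈ univ.filter (· ∈ H), #C < ∑ d ∈ univ.filter (· ∈ H),
        2 * #{p ∈ C | p + d ∈ C} :=
      sum_lt_sum_of_nonempty ⟨0, by simp [H.zero_mem]⟩ fun d hd => (mem_filter.1 hd).2
    rw [← mul_sum, sum_const, smul_eq_mul] at h2
    have h3 : Nat.card H = #(univ.filter (· ∈ H)) := by
      rw [Nat.card_eq_fintype_card, Fintype.card_subtype]
    rw [h3]
    by_contra! h4
    nlinarith
  · have := hd x hx 0 h0
    rwa [sub_zero] at this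

/-- If `g` is not a double and not a sum of at most four distinct elements of `C`, where `C` has
about half the size of the group, then `C` has few sums of two distinct elements. -/
theorem card_offDiag_sums_lt [Fintype G] (C : Finset G) (h0 : (0 : G) ∈ C) (g : G)
    (hc : 17 ≤ #C) (hn : Fintype.card G ≤ 2 * #C + 2) (h2 : ∀ x : G, x + x ≠ g)
    (hg : ∀ B ⊆ C, ∑ x ∈ B, x ≠ g) :
    2 * #(C.offDiag.image fun z => z.1 + z.2) + 4 < 3 * #C := by
  set U := C.offDiag.image fun z => z.1 + z.2 with hU
  have hpair : ∀ x ∈ C, ∀ y ∈ C, x + y ≠ g := by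
    intro x hx y hy hxy
    have hne : x ≠ y := fun h => h2 x (by rw [← hxy, h])
    exact hg {x, y} (by simp [insert_subset_iff, hx, hy]) (by rw [sum_pair hne, hxy])
  -- elements represented neither in `C` nor in `g - C`
  let E : Finset G := univ.filter fun y => y ∉ C ∧ g - y ∉ C
  have hE : #E ≤ 2 := by
    have hdisj : Disjoint C (C.image (g - ·)) := by
      rw [disjoint_left]
      intro x hx hx'
      obtain ⟨y, hy, rfl⟩ := mem_image.1 hx'
      exact hpair _ hx _ hy (by abel)
    have hE' : E ⊆ univ \ (C ∪ C.image (g - ·)) := by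
      intro y hy
      simp only [E, mem_filter, mem_univ, true_and] at hy
      simp only [mem_sdiff, mem_univ, true_and, mem_union, mem_image, not_or, not_exists, not_and]
      refine ⟨hy.1, fun z hz hzy => hy.2 ?_⟩
      rw [← hzy]; simpa using hz
    have := card_le_card hE'
    rw [card_sdiff_of_subset (subset_univ _), card_union_of_disjoint hdisj,
      card_image_of_injective _ (sub_right_injective), card_univ] at this
    omega
  -- the translates of `C` by elements of a set `V`
  have hlow : ∀ V : Finset G, #V * #C ≤ #C * #C + ∑ t ∈ V, #{x ∈ C | x + t ∉ C} := by
    intro V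
    have h1 : ∑ t ∈ V, #{x ∈ C | x + t ∈ C} ≤ #C * #C := by
      simp only [card_filter]
      rw [sum_comm, ← smul_eq_mul]
      refine sum_le_card_nsmul _ _ _ fun p _ => ?_
      rw [← card_filter]
      refine card_le_card_of_injOn (fun d => p + d) ?_ ?_
      · intro d hd
        simp only [coe_filter, Set.mem_ofPred_eq] at hd
        exact hd.2
      · intro d _ d' _ hdd; simpa using hdd
    have h3 : ∑ t ∈ V, (#{x ∈ C | x + t ∈ C} + #{x ∈ C | x + t ∉ C}) = #V * #C := by
      rw [← smul_eq_mul, ← sum_const]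
      exact sum_congr rfl fun t _ => card_filter_add_card_filter_not _
    rw [sum_add_distrib] at h3
    omega
  have hEsum : ∀ V : Finset G, ∑ t ∈ V, #{x ∈ C | x + t ∈ E} ≤ #C * 2 := by
    intro V
    simp only [card_filter]
    rw [sum_comm, ← smul_eq_mul]
    refine sum_le_card_nsmul _ _ _ fun p _ => ?_
    rw [← card_filter]
    refine le_trans (card_le_card_of_injOn (t := E) (fun d => p + d) ?_ ?_) hE
    · intro d hd
      simp only [coe_filter, Set.mem_ofPred_eq] at hd
      exact hd.2
    · intro d _ d' _ hdd; simpa using hdd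
  have hSsum : ∀ V : Finset G, ∑ t ∈ V, #{x ∈ C | x + x + t = g} ≤ #C * 1 := by
    intro V
    simp only [card_filter]
    rw [sum_comm, ← smul_eq_mul]
    refine sum_le_card_nsmul _ _ _ fun p _ => ?_
    rw [← card_filter, card_le_one]
    intro a ha b hb
    have h1 := (mem_filter.1 ha).2
    have h2 := (mem_filter.1 hb).2
    exact add_left_cancel (h1.trans h2.symm)
  have hsplit : ∀ t : G, #{x ∈ C | x + t ∉ C} ≤
      #{x ∈ C | x + t ∈ E} + #{x ∈ C | g - t - x ∈ C} := by
    intro t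
    refine le_trans (card_le_card ?_) (card_union_le _ _)
    intro x hx
    simp only [mem_filter, mem_union, E, mem_univ, true_and] at hx ⊢
    by_cases h : g - t - x ∈ C
    · exact Or.inr ⟨hx.1, h⟩
    · refine Or.inl ⟨hx.1, hx.2, ?_⟩
      rwa [show g - (x + t) = g - t - x by abel]
  have hr : ∀ T ⊆ C, ∀ t : G, ∑ x ∈ T, x = t →
      #{x ∈ C | g - t - x ∈ C} ≤ 2 * #T + #{x ∈ C | x + x + t = g} := by
    intro T hT t ht
    have : {x ∈ C | g - t - x ∈ C} ⊆
        (T ∪ T.image (g - t - ·)) ∪ {x ∈ C | x + x + t = g} := by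
      intro x hx
      simp only [mem_filter] at hx
      by_cases h1 : x ∈ T
      · simp [h1]
      by_cases h3 : g - t - x ∈ T
      · refine mem_union_left _ (mem_union_right _ (mem_image.2 ⟨_, h3, ?_⟩))
        abel
      refine mem_union_right _ (mem_filter.2 ⟨hx.1, ?_⟩)
      by_contra h4
      have h5 : x ≠ g - t - x := by
        intro h
        apply h4
        nth_rewrite 2 [h]
        abel
      refine hg (insert x (insert (g - t - x) T)) ?_ ?_
      · simp [insert_subset_iff, hx.1, hx.2, hT]
      · rw [sum_insert (by simp [h1, h5]), sum_insert h3, ht]; abel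
    have h3 := card_le_card this
    have h4 := card_union_le (T ∪ T.image (g - t - ·)) {x ∈ C | x + x + t = g}
    have h5 := card_union_le T (T.image (g - t - ·))
    have h6 : #(T.image (g - t - ·)) ≤ #T := card_image_le
    omega
  have hCsum : ∑ t ∈ C, #{x ∈ C | x + t ∉ C} ≤ ∑ t ∈ C, #{x ∈ C | x + t ∈ E} + 2 * (#C - 1) +
      ∑ t ∈ C, #{x ∈ C | x + x + t = g} := by
    have h1 : ∑ t ∈ C, (if t = 0 then 0 else 2) = 2 * (#C - 1) := by
      rw [← Finset.sum_erase_add _ _ h0, if_pos rfl, sum_congr rfl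
        (fun x hx => if_neg (ne_of_mem_erase hx)), sum_const, card_erase_of_mem h0, smul_eq_mul]
      omega
    rw [← h1, ← sum_add_distrib, ← sum_add_distrib]
    refine sum_le_sum fun t ht => (hsplit t).trans ?_
    split_ifs with h
    · have := hr ∅ (by simp) t (by simp [h])
      simp at this ⊢; omega
    · have := hr {t} (by simpa using ht) t (by simp)
      simp at this ⊢; omega
  have hUsum : ∑ t ∈ U \ C, #{x ∈ C | x + t ∉ C} ≤ ∑ t ∈ U \ C, #{x ∈ C | x + t ∈ E} +
      #(U \ C) * 4 + ∑ t ∈ U \ C, #{x ∈ C | x + x + t = g} := by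
    rw [← smul_eq_mul, ← sum_const, ← sum_add_distrib, ← sum_add_distrib]
    refine sum_le_sum fun t ht => (hsplit t).trans ?_
    obtain ⟨z, hz, rfl⟩ := mem_image.1 (mem_sdiff.1 ht).1
    rw [mem_offDiag] at hz
    have := hr {z.1, z.2} (by simp [insert_subset_iff, hz.1, hz.2.1]) (z.1 + z.2)
      (sum_pair hz.2.2)
    rw [card_pair hz.2.2] at this
    omega
  have hlow' := hlow (C ∪ U \ C)
  have hE' := hEsum (C ∪ U \ C)
  have hS' := hSsum (C ∪ U \ C)
  have hdisj : Disjoint C (U \ C) := disjoint_sdiff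
  rw [sum_union hdisj, card_union_of_disjoint hdisj] at hlow'
  rw [sum_union hdisj] at hE' hS'
  have hUle : #U ≤ #C + #(U \ C) := by
    have h1 : U ⊆ C ∪ U \ C := fun x hx => by
      by_cases h : x ∈ C <;> simp [h, hx]
    exact (card_le_card h1).trans (card_union_le _ _)
  by_contra! hcon
  obtain ⟨k, hk⟩ : ∃ k, #C = k + 17 := ⟨#C - 17, by omega⟩
  rw [hk, Nat.add_sub_assoc (by norm_num)] at hCsum
  rw [hk] at hlow' hE' hS' hcon hUle
  have hfin : (k + 17) * #(U \ C) ≤ 5 * k + 83 + 4 * #(U \ C) := by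
    rw [add_mul, mul_comm #(U \ C)] at hlow'
    omega
  have hlarge : k + 13 ≤ 2 * #(U \ C) := by omega
  nlinarith

/-- A set of about half the size of the group which contains `0` and whose subset sums miss
some `g ∉ 2G` lies in a subgroup of index two. -/
theorem exists_half_subgroup [Fintype G] (C : Finset G) (h0 : (0 : G) ∈ C) (g : G)
    (hG : 36 ≤ Fintype.card G)
    (hn : Fintype.card G ≤ 2 * #C + 2) (h2 : ∀ x : G, x + x ≠ g)
    (hg : ∀ B ⊆ C, ∑ x ∈ B, x ≠ g) :
    ∃ H : AddSubgroup G, Nat.card H = Fintype.card G / 2 ∧ ∀ x ∈ C, x ∈ H := by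
  have hU := card_offDiag_sums_lt C h0 g (by omega) hn h2 hg
  set U := C.offDiag.image fun z => z.1 + z.2 with hUdef
  have htrans : ∀ x ∈ C, (C.erase x).image (x + ·) ⊆ U := by
    intro x hx z hz
    obtain ⟨p, hp, rfl⟩ := mem_image.1 hz
    rw [mem_erase] at hp
    exact mem_image.2 ⟨(x, p), mem_offDiag.2 ⟨hx, hp.2, hp.1.symm⟩, rfl⟩
  have hcard : ∀ x ∈ C, #((C.erase x).image (x + ·)) = #C - 1 := by
    intro x hx
    rw [card_image_of_injective _ (add_right_injective x), card_erase_of_mem hx]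
  obtain ⟨H, hH, hCH⟩ := exists_addSubgroup_of_popular_differences C h0 (by
    intro x hx y hy _
    have h3 := card_union_add_card_inter ((C.erase x).image (x + ·)) ((C.erase y).image (y + ·))
    have h4 := card_le_card (union_subset (htrans x hx) (htrans y hy))
    rw [hcard x hx, hcard y hy] at h3
    have h5 : #((C.erase x).image (x + ·) ∩ (C.erase y).image (y + ·)) ≤
        #{p ∈ C | p + (x - y) ∈ C} := by
      refine card_le_card_of_injOn (fun z => z - x) ?_ ?_
      · intro z hz
        simp only [coe_inter, coe_image, Set.mem_inter_iff, Set.mem_image, mem_coe,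
          mem_erase] at hz
        obtain ⟨⟨p, hp, rfl⟩, q, hq, hqp⟩ := hz
        simp only [coe_filter, Set.mem_ofPred_eq, add_sub_cancel_left]
        refine ⟨hp.2, ?_⟩
        rw [← add_sub_assoc, add_comm p x, ← hqp, add_sub_cancel_left]
        exact hq.2
      · intro a _ b _ hab; simpa using hab
    omega)
  refine ⟨H, ?_, hCH⟩
  have hCle : #C ≤ Nat.card H := by
    classical
    rw [Nat.card_eq_fintype_card, Fintype.card_subtype]
    exact card_le_card fun x hx => by simpa using hCH x hx
  have hCn : 2 * #C ≤ Fintype.card G := by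
    have hdisj : Disjoint C (C.image (g - ·)) := by
      rw [disjoint_left]
      intro x hx hx'
      obtain ⟨y, hy, hxy⟩ := mem_image.1 hx'
      have hne : x ≠ y := fun h => h2 y (by rw [← h]; nth_rewrite 1 [← hxy]; rw [h]; abel)
      exact hg {x, y} (by simp [insert_subset_iff, hx, hy])
        (by rw [sum_pair hne, ← hxy]; abel)
    have := card_le_univ (C ∪ C.image (g - ·))
    rw [card_union_of_disjoint hdisj, card_image_of_injective _ sub_right_injective] at this
    omega
  obtain ⟨m, hm⟩ := H.card_addSubgroup_dvd_card
  rw [Nat.card_eq_fintype_card] at hm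
  have hm2 : m < 3 := by
    by_contra! h
    nlinarith
  interval_cases m <;> omega

/-- In a subgroup of order greater than `12`, every element is a sum of three distinct elements
of any subset omitting at most two elements. -/
theorem exists_three_sum [Fintype G] (H : AddSubgroup G) (P : Finset G) (hP : ∀ x ∈ P, x ∈ H)
    (hH : 12 < Nat.card H) (hc : Nat.card H ≤ #P + 2) (h : G) (hh : h ∈ H) :
    ∃ B ⊆ P, B.Nonempty ∧ ∑ x ∈ B, x = h := by
  classical
  let Q : Finset G := univ.filter (· ∈ H)
  have hQ : #Q = Nat.card H := by rw [Nat.card_eq_fintype_card, Fintype.card_subtype]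
  have hPQ : P ⊆ Q := fun x hx => by simpa [Q] using hP x hx
  obtain ⟨a, haP, hah⟩ := exists_mem_ne (show 1 < #P by omega) h
  have haH := hP a haP
  let F := Q.filter fun x => x + x = h - a
  have hF : 2 * #F ≤ #Q := by
    rcases F.eq_empty_or_nonempty with h1 | ⟨f, hf⟩
    · simp [h1]
    have hdisj : Disjoint F (F.image (· - f)) := by
      rw [disjoint_left]
      intro x hx hx'
      obtain ⟨y, hy, rfl⟩ := mem_image.1 hx'
      have e1 := (mem_filter.1 hx).2
      have e2 := (mem_filter.1 hy).2
      have e3 := (mem_filter.1 hf).2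
      rw [show y - f + (y - f) = (y + y) - (f + f) by abel, e2, e3, sub_self] at e1
      exact hah (sub_eq_zero.1 e1.symm).symm
    have hsub : F ∪ F.image (· - f) ⊆ Q := by
      refine union_subset (filter_subset _ _) fun x hx => ?_
      obtain ⟨y, hy, rfl⟩ := mem_image.1 hx
      simp only [F, Q, mem_filter, mem_univ, true_and] at hy hf ⊢
      exact H.sub_mem hy.1 hf.1
    have := card_le_card hsub
    rw [card_union_of_disjoint hdisj, card_image_of_injective _ (sub_left_injective)] at this
    omega
  let W := Q \ P.erase a
  have hW : #W ≤ 3 := by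
    rw [card_sdiff_of_subset ((erase_subset _ _).trans hPQ), card_erase_of_mem haP]
    omega
  have hbad : #(W ∪ W.image (h - a - ·) ∪ F) < #Q := by
    have h4 := card_union_le (W ∪ W.image (h - a - ·)) F
    have h5 := card_union_le W (W.image (h - a - ·))
    have h6 : #(W.image (h - a - ·)) ≤ #W := card_image_le
    omega
  obtain ⟨b, hb, hb'⟩ := exists_mem_notMem_of_card_lt_card hbad
  simp only [mem_union, not_or] at hb'
  obtain ⟨⟨hb1, hb2⟩, hb3⟩ := hb'
  have hbH : b ∈ H := by simpa [Q] using hb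
  have hbP : b ∈ P.erase a := by
    by_contra h1
    exact hb1 (mem_sdiff.2 ⟨hb, h1⟩)
  have hcP : h - a - b ∈ P.erase a := by
    by_contra h1
    refine hb2 (mem_image.2 ⟨h - a - b, mem_sdiff.2 ⟨?_, h1⟩, by abel⟩)
    simpa [Q] using H.sub_mem (H.sub_mem hh haH) hbH
  have hne : b ≠ h - a - b := by
    intro h1
    exact hb3 (mem_filter.2 ⟨hb, by nth_rewrite 2 [h1]; abel⟩)
  rw [mem_erase] at hbP hcP
  refine ⟨{a, b, h - a - b}, by simp [insert_subset_iff, haP, hbP.2, hcP.2], by simp, ?_⟩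
  rw [sum_insert (by simp [hbP.1.symm, hcP.1.symm]), sum_pair hne]
  abel

theorem half_le_cr [Fintype G] (heven : 2 ∣ Fintype.card G) :
    Fintype.card G / 2 ≤ cr G := by
  classical
  have hne : {ℓ : ℕ | 0 < ℓ ∧ ∀ A : Finset G, (0 : G) ∉ A → ℓ ≤ A.card →
      nss A = Finset.univ}.Nonempty := by
    refine ⟨Fintype.card G, Fintype.card_pos, fun A hA hc => absurd ?_ hA⟩
    rw [(card_eq_iff_eq_univ A).1 (le_antisymm (card_le_univ A) hc)]
    exact mem_univ 0
  obtain ⟨H, hH⟩ := exists_index_eq_two heven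
  have hcard := H.card_mul_index
  rw [hH, Nat.card_eq_fintype_card (α := G)] at hcard
  let Q : Finset G := univ.filter (· ∈ H)
  have hQ : #Q = Nat.card H := by rw [Nat.card_eq_fintype_card, Fintype.card_subtype]
  refine le_csInf hne ?_
  rintro ℓ ⟨hpos, hℓ⟩
  by_contra! hlt
  have h0 : (0 : G) ∈ Q := by simp [Q, H.zero_mem]
  have hspan := hℓ (Q.erase 0) (by simp) (by rw [card_erase_of_mem h0]; omega)
  have htop : H = ⊤ := by
    rw [eq_top_iff]
    intro x _
    obtain ⟨B, hB, -, rfl⟩ := mem_nss.1 (hspan ▸ mem_univ x)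
    refine H.sum_mem fun y hy => ?_
    have := mem_of_mem_erase (hB hy)
    simpa [Q] using this
  rw [htop, AddSubgroup.index_top] at hH
  omega

theorem eq_of_insert_zero_subset [Fintype G] (A : Finset G) (hA0 : (0 : G) ∉ A)
    (H : AddSubgroup G) (hH : Nat.card H ≤ #A + 1) (hA : ∀ x ∈ A, x ∈ H) :
    (A : Set G) = (H : Set G) \ {0} := by
  classical
  let Q : Finset G := univ.filter (· ∈ H)
  have hQ : #Q = Nat.card H := by rw [Nat.card_eq_fintype_card, Fintype.card_subtype]
  have hsub : insert 0 A ⊆ Q := by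
    refine insert_subset (by simp [Q, H.zero_mem]) fun x hx => by simpa [Q] using hA x hx
  have heq := eq_of_subset_of_card_le hsub (by rw [card_insert_of_notMem hA0]; omega)
  ext x
  simp only [Set.mem_sdiff, SetLike.mem_coe, Set.mem_singleton_iff]
  constructor
  · intro hx
    exact ⟨hA x hx, fun h => hA0 (h ▸ hx)⟩
  · rintro ⟨hx, hx0⟩
    have : x ∈ insert 0 A := by rw [heq]; simpa [Q] using hx
    exact (mem_insert.1 this).resolve_left hx0

end

theorem stmt0 {G : Type*} [AddCommGroup G] [Fintype G] [DecidableEq G]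
    (hp : (Fintype.card G).minFac = 2) (hG : 36 ≤ Fintype.card G)
    (A : Finset G) (hA0 : (0 : G) ∉ A) (hcard : A.card = cr G - 1)
    (hns : nss A ≠ Finset.univ) :
    ∃ H : AddSubgroup G, Nat.card H = Fintype.card G / 2 ∧
      (A : Set G) = (H : Set G) \ {0} := by
  have heven : 2 ∣ Fintype.card G := hp ▸ Nat.minFac_dvd _
  have hcr := half_le_cr heven
  have hA : Fintype.card G ≤ 2 * #A + 2 := by omega
  obtain ⟨g, hg⟩ : ∃ g, g ∉ nss A := by
    by_contra! h
    exact hns (eq_univ_iff_forall.2 h)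
  have hmiss : ∀ B ⊆ A, B.Nonempty → ∑ x ∈ B, x ≠ g := fun B hB hne h =>
    hg (mem_nss.2 ⟨B, hB, hne, h⟩)
  have hsum0 : ∀ B : Finset G, ∑ x ∈ B.erase 0, x = ∑ x ∈ B, x := fun B =>
    sum_erase B rfl
  by_cases h2 : ∀ x : G, x + x ≠ g
  · obtain ⟨H, hH, hCH⟩ := exists_half_subgroup (insert 0 A) (mem_insert_self _ _) g hG
      (by rw [card_insert_of_notMem hA0]; omega) h2 (by
        intro B hB h
        rw [← hsum0] at h
        rcases (B.erase 0).eq_empty_or_nonempty with h1 | h1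
        · rw [h1, sum_empty] at h
          exact h2 0 (by rw [← h, add_zero])
        · exact hmiss _ (by rwa [← subset_insert_iff]) h1 h)
    exact ⟨H, hH, eq_of_insert_zero_subset A hA0 H (by omega)
      fun x hx => hCH x (mem_insert_of_mem hx)⟩
  push Not at h2
  obtain ⟨u, hu⟩ := h2
  by_cases hAD : ∀ x ∈ A, x ∈ (nsmulAddMonoidHom (α := G) 2).range
  · have h3 := card_le_half_of_ne_top _ (range_two_nsmul_ne_top heven)
    have h4 := eq_of_insert_zero_subset A hA0 _ (by omega) hAD
    refine ⟨_, ?_, h4⟩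
    have h5 : #A + 1 ≤ Nat.card (nsmulAddMonoidHom (α := G) 2).range := by
      classical
      rw [← card_insert_of_notMem hA0, Nat.card_eq_fintype_card, Fintype.card_subtype]
      refine card_le_card (insert_subset
        (mem_filter.2 ⟨mem_univ _, (nsmulAddMonoidHom (α := G) 2).range.zero_mem⟩) fun x hx => ?_)
      rw [mem_filter]
      exact ⟨mem_univ _, hAD x hx⟩
    omega
  push Not at hAD
  obtain ⟨b, hbA, hb⟩ := hAD
  have hAb : (0 : G) ∉ A.erase b := fun h => hA0 (mem_of_mem_erase h)
  have hcb : #(A.erase b) = #A - 1 := card_erase_of_mem hbA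
  have hbmiss : ∀ B ⊆ A.erase b, ∑ x ∈ B, x ≠ g - b := by
    intro B hB h
    have hbB : b ∉ B := fun h => by simpa using hB h
    refine hmiss (insert b B) (insert_subset hbA (hB.trans (erase_subset _ _))) (by simp) ?_
    rw [sum_insert hbB, h]; abel
  obtain ⟨H, hH, hCH⟩ := exists_half_subgroup (insert 0 (A.erase b)) (mem_insert_self _ _)
    (g - b) hG (by rw [card_insert_of_notMem hAb]; omega) (by
      intro x hx
      refine hb ⟨u - x, ?_⟩
      simp only [nsmulAddMonoidHom_apply, two_nsmul]
      rw [show u - x + (u - x) = (u + u) - (x + x) by abel, hu, hx]; abel) (by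
      intro B hB h
      rw [← hsum0] at h
      exact hbmiss _ (by rwa [← subset_insert_iff]) h)
  have hAH : ∀ x ∈ A.erase b, x ∈ H := fun x hx => hCH x (mem_insert_of_mem hx)
  by_cases hbH : b ∈ H
  · refine ⟨H, hH, eq_of_insert_zero_subset A hA0 H (by omega) fun x hx => ?_⟩
    by_cases hxb : x = b
    · rwa [hxb]
    · exact hAH x (mem_erase.2 ⟨hxb, hx⟩)
  exfalso
  have h3 := exists_three_sum H (A.erase b) hAH (by omega) (by omega)
  have hindex : H.index = 2 := by
    have h4 := H.card_mul_index
    rw [Nat.card_eq_fintype_card (α := G)] at h4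
    have h5 : Nat.card H * 2 = Fintype.card G := by omega
    exact Nat.eq_of_mul_eq_mul_left (by omega) (h4.trans h5.symm)
  by_cases hgH : g ∈ H
  · obtain ⟨B, hB, hne, h⟩ := h3 g hgH
    exact hmiss B (hB.trans (erase_subset _ _)) hne h
  · have : g - b ∈ H := by
      rw [sub_eq_add_neg, AddSubgroup.add_mem_iff_of_index_two hindex, H.neg_mem_iff]
      exact iff_of_false hgH hbH
    obtain ⟨B, hB, -, h⟩ := h3 _ this
    exact hbmiss B hB h
end

section
/- Let G be a finite abelian group and let p be the smallest prime divisor of |G|. Assume p ≥ 3 and that |G|/p is a prime number with |G|/p ≥ 2p + 3. Let A ⊆ G \ {0} be a subset of cardinality cr(G) − 1 such that Σ(A) ≠ G. Then there exist a subgroup H of G of order |G|/p and an element g ∈ G \ H such that H \ {0} ⊆ A and A ⊆ H ∪ (g + H) ∪ (−g + H). -/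
open Finset

/-- The set of sums of `k`-element subsets of `B`. -/
def kSums {R : Type*} [AddCommMonoid R] [DecidableEq R] (k : ℕ) (B : Finset R) : Finset R :=
  (B.powersetCard k).image fun T => ∑ x ∈ T, x

section DiasDaSilvaHamidoune

open MvPolynomial

lemma prod_factorial_mul_coeff_monomial_mul_sum_pow {R : Type*} [CommRing R] {k : ℕ}
    (s : Fin k →₀ ℕ) (N : ℕ) (t : Fin k →₀ ℕ) (ht : ∑ i, t i = ∑ i, s i + N) :
    ((∏ i, (t i).factorial : ℕ) : R) *
        coeff t (monomial s (1 : R) * (∑ i, X i : MvPolynomial (Fin k) R) ^ N) =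
      ((N.factorial * ∏ i, (t i).descFactorial (s i) : ℕ) : R) := by
  induction N generalizing t with
  | zero =>
    rw [pow_zero, mul_one, coeff_monomial]
    split_ifs with h
    · subst h
      simp [Nat.descFactorial_self]
    · obtain ⟨i, hi⟩ : ∃ i, t i < s i := by
        by_contra! hcon
        apply h
        ext i
        have := (Finset.sum_eq_sum_iff_of_le (s := univ) (fun i _ => hcon i)).1 (by simpa using ht.symm)
        exact this i (mem_univ i)
      rw [Finset.prod_eq_zero (f := fun i => (t i).descFactorial (s i)) (mem_univ i)
        (Nat.descFactorial_of_lt hi)]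
      simp
  | succ N ih =>
    rw [pow_succ, ← mul_assoc, Finset.mul_sum, coeff_sum, Finset.mul_sum]
    have key : ∀ i : Fin k, ((∏ i, (t i).factorial : ℕ) : R) *
        coeff t (monomial s (1 : R) * (∑ i, X i : MvPolynomial (Fin k) R) ^ N * X i) =
        ((t i : R) - s i) * ((N.factorial * ∏ i, (t i).descFactorial (s i) : ℕ) : R) := by
      intro i
      rw [coeff_mul_X']
      have hsplit : ∀ f : Fin k → ℕ, ∏ j, f j = f i * ∏ j ∈ univ.erase i, f j := fun f =>
        (Finset.mul_prod_erase _ _ (mem_univ i)).symm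
      split_ifs with h
      · rw [Finsupp.mem_support_iff] at h
        set u := t - Finsupp.single i 1 with hu
        have hui : t i = u i + 1 := by
          simp [hu]; omega
        have huj : ∀ j ∈ univ.erase i, t j = u j := by
          intro j hj
          simp [hu, (Finset.ne_of_mem_erase hj).symm]
        have h1 := ih u (by
          have e1 := Finset.add_sum_erase univ (fun j => t j) (mem_univ i)
          have e2 := Finset.add_sum_erase univ (fun j => u j) (mem_univ i)
          have e3 : ∑ j ∈ univ.erase i, t j = ∑ j ∈ univ.erase i, u j :=
            Finset.sum_congr rfl huj
          omega)
        have hfac : ∏ j ∈ univ.erase i, (t j).factorial = ∏ j ∈ univ.erase i, (u j).factorial :=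
          Finset.prod_congr rfl fun j hj => by rw [huj j hj]
        have hdesc : ∏ j ∈ univ.erase i, (t j).descFactorial (s j) =
            ∏ j ∈ univ.erase i, (u j).descFactorial (s j) :=
          Finset.prod_congr rfl fun j hj => by rw [huj j hj]
        rw [hsplit (fun j => (t j).factorial), hsplit (fun j => (t j).descFactorial (s j)),
          hfac, hdesc]
        rw [hsplit (fun j => (u j).factorial), hsplit (fun j => (u j).descFactorial (s j))] at h1
        have h2 : (((u i + 1) * (u i).descFactorial (s i) : ℕ) : R) =
            ((t i : R) - s i) * ((t i).descFactorial (s i) : R) := by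
          rw [← Nat.succ_descFactorial_succ, Nat.descFactorial_succ, hui]
          by_cases hs : s i ≤ u i + 1
          · push_cast [Nat.cast_sub hs]; ring
          · rw [Nat.descFactorial_of_lt (by omega)]; simp
        rw [hui] at h2 ⊢
        rw [Nat.factorial_succ]
        push_cast at h1 h2 ⊢
        linear_combination ((u i : R) + 1) * h1 + (N.factorial : R) *
          (∏ x ∈ univ.erase i, ((u x).descFactorial (s x) : R)) * h2
      · rw [Finsupp.notMem_support_iff] at h
        rw [hsplit (fun j => (t j).descFactorial (s j)), h]
        rcases Nat.eq_zero_or_pos (s i) with h0 | h0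
        · simp [h0]
        · rw [Nat.descFactorial_of_lt h0]; simp
    rw [Finset.sum_congr rfl (fun i _ => key i), ← Finset.sum_mul, Finset.sum_sub_distrib]
    have : (∑ i, (t i : R)) = ∑ i, (s i : R) + (N + 1) := by
      exact_mod_cast congrArg (Nat.cast : ℕ → R) ht
    rw [this, Nat.factorial_succ]
    push_cast
    ring

lemma coeff_mul_prod_sub_C {R σ : Type*} [CommRing R] [Fintype σ] (E : Finset R) (d : ℕ)
    (P : MvPolynomial σ R) (hP : P.totalDegree ≤ d) (t : σ →₀ ℕ) (ht : ∑ i, t i = d + #E) :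
    coeff t (P * ∏ e ∈ E, ((∑ i, X i) - C e)) = coeff t (P * (∑ i, X i) ^ #E) := by
  classical
  have hS : (∑ i, X i : MvPolynomial σ R).totalDegree ≤ 1 := by
    refine totalDegree_finsetSum_le fun i _ => ?_
    rw [X]
    exact (totalDegree_monomial_le _ _).trans (by simp)
  induction E using Finset.induction_on generalizing P d with
  | empty => simp
  | insert e E he ih =>
    rw [Finset.prod_insert he, ← mul_assoc, Finset.card_insert_of_notMem he]
    rw [Finset.card_insert_of_notMem he] at ht
    have h1 : (P * ((∑ i, X i) - C e)).totalDegree ≤ d + 1 := by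
      refine (totalDegree_mul _ _).trans (add_le_add hP ?_)
      refine (totalDegree_sub _ _).trans ?_
      simp [hS]
    rw [ih (d + 1) _ h1 (by omega)]
    have h2 : coeff t (P * (∑ i, X i) ^ #E) = 0 := by
      apply coeff_eq_zero_of_totalDegree_lt
      have h3 : ∑ i ∈ t.support, t i = ∑ i, t i := by
        apply Finset.sum_subset (subset_univ _)
        intro i _ hi
        simpa using hi
      rw [h3, ht]
      refine lt_of_le_of_lt ((totalDegree_mul _ _).trans (add_le_add hP
        ((totalDegree_pow _ _).trans (Nat.mul_le_mul_left _ hS)))) (by omega)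
    have h4 : P * ((∑ i, X i) - C e) * (∑ i, X i) ^ #E =
        P * (∑ i, X i) ^ (#E + 1) - C e * (P * (∑ i, X i) ^ #E) := by ring
    rw [h4, coeff_sub, coeff_C_mul, h2, mul_zero, sub_zero]

lemma coeff_det_vandermonde_mul_sum_pow_ne_zero {q : ℕ} [Fact q.Prime] {k N : ℕ} (t : Fin k →₀ ℕ)
    (hinj : Function.Injective t) (hlt : ∀ i, t i < q) (hN : N < q)
    (hsum : ∑ i, t i = N + ∑ i : Fin k, (i : ℕ)) :
    coeff t ((Matrix.vandermonde (X : Fin k → MvPolynomial (Fin k) (ZMod q))).det *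
      (∑ i, X i) ^ N) ≠ 0 := by
  have hq : q.Prime := Fact.out
  have hdet : ((Matrix.vandermonde (X : Fin k → MvPolynomial (Fin k) (ZMod q))).det *
      (∑ i, X i) ^ N) = ∑ σ : Equiv.Perm (Fin k), C ((Equiv.Perm.sign σ : ℤ) : ZMod q) *
        (monomial (Finsupp.equivFunOnFinite.symm fun i => ((σ i : Fin k) : ℕ)) 1 *
          (∑ i, X i) ^ N) := by
    rw [← Matrix.det_transpose, Matrix.det_apply', Finset.sum_mul]
    refine Finset.sum_congr rfl fun σ _ => ?_
    have hmon : ∏ i, (Matrix.vandermonde (X : Fin k → MvPolynomial (Fin k) (ZMod q))).transpose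
        (σ i) i = monomial (Finsupp.equivFunOnFinite.symm fun i => ((σ i : Fin k) : ℕ)) 1 := by
      rw [monomial_eq]
      simp only [C_1, one_mul, Matrix.transpose_apply, Matrix.vandermonde_apply]
      rw [Finsupp.prod_fintype _ _ (by simp)]
      simp
    rw [hmon, mul_assoc, map_intCast]
  have hfact : (((∏ i, (t i).factorial : ℕ) : ZMod q)) *
      coeff t ((Matrix.vandermonde (X : Fin k → MvPolynomial (Fin k) (ZMod q))).det *
      (∑ i, X i) ^ N) = (N.factorial : ZMod q) *
        (Matrix.vandermonde fun i => (t i : ZMod q)).det := by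
    rw [hdet, coeff_sum, Finset.mul_sum,
      Matrix.det_eval_matrixOfPolynomials_eq_det_vandermonde (fun i => (t i : ZMod q))
        (fun i => descPochhammer (ZMod q) i) (fun i => descPochhammer_natDegree _ _)
        (fun i => monic_descPochhammer _ _),
      ← Matrix.det_transpose, Matrix.det_apply', Finset.mul_sum]
    refine Finset.sum_congr rfl fun σ _ => ?_
    rw [coeff_C_mul, mul_left_comm, prod_factorial_mul_coeff_monomial_mul_sum_pow]
    · simp only [Matrix.transpose_apply, Matrix.of_apply, descPochhammer_eval_eq_descFactorial]
      push_cast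
      simp only [Finsupp.equivFunOnFinite_symm_apply_apply]
      ring
    · rw [hsum, add_comm]
      congr 1
      simp only [Finsupp.equivFunOnFinite_symm_apply_apply]
      exact (Equiv.sum_comp σ (fun i => (i : ℕ))).symm
  intro h0
  rw [h0, mul_zero] at hfact
  refine mul_ne_zero ?_ (Matrix.det_vandermonde_ne_zero_iff.2 ?_) hfact.symm
  · rw [Ne, ZMod.natCast_eq_zero_iff, hq.dvd_factorial]
    omega
  · intro i j hij
    apply hinj
    have := (ZMod.natCast_eq_natCast_iff' _ _ _).1 hij
    rwa [Nat.mod_eq_of_lt (hlt i), Nat.mod_eq_of_lt (hlt j)] at this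

lemma lt_card_kSums_of_injective {q : ℕ} [Fact q.Prime] {k N : ℕ} (B : Finset (ZMod q))
    (c : Fin k → ℕ) (hinj : Function.Injective c) (hlt : ∀ i, c i < #B) (hN : N < q)
    (hsum : ∑ i, c i = N + ∑ i : Fin k, (i : ℕ)) : N < #(kSums k B) := by
  by_contra! hle
  obtain ⟨E, hE, hEc⟩ := Finset.exists_superset_card_eq hle (by rw [ZMod.card]; exact hN.le)
  have hBq : #B ≤ q := by simpa [ZMod.card] using Finset.card_le_univ B
  set t : Fin k →₀ ℕ := Finsupp.equivFunOnFinite.symm c with ht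
  have htc : ∀ i, t i = c i := fun i => rfl
  set V := (Matrix.vandermonde (X : Fin k → MvPolynomial (Fin k) (ZMod q))).det with hV
  have hVdeg : V.totalDegree ≤ ∑ i : Fin k, (i : ℕ) := by
    rw [hV, Matrix.det_apply']
    refine totalDegree_finsetSum_le fun σ _ => ?_
    refine (totalDegree_mul _ _).trans ?_
    have h1 : (((Equiv.Perm.sign σ : ℤ) : MvPolynomial (Fin k) (ZMod q))).totalDegree = 0 := by
      rw [show (((Equiv.Perm.sign σ : ℤ) : MvPolynomial (Fin k) (ZMod q))) =
        C ((Equiv.Perm.sign σ : ℤ) : ZMod q) by simp, totalDegree_C]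
    rw [h1, zero_add]
    refine (totalDegree_finsetProd _ _).trans (Finset.sum_le_sum fun i _ => ?_)
    rw [Matrix.vandermonde_apply]
    exact (totalDegree_pow _ _).trans (by simp)
  set F := V * ∏ e ∈ E, ((∑ i, X i) - C e) with hF
  have hcoeff : coeff t F ≠ 0 := by
    rw [hF, coeff_mul_prod_sub_C E _ V hVdeg t (by rw [hEc]; simp only [htc]; omega), hEc]
    exact coeff_det_vandermonde_mul_sum_pow_ne_zero t hinj
      (fun i => (hlt i).trans_le hBq) hN hsum
  have htdeg : t.degree = ∑ i, c i := by
    rw [Finsupp.degree_eq_sum]; rfl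
  have hdeg : F.totalDegree = t.degree := by
    apply le_antisymm
    · rw [htdeg, hsum, ← hEc, add_comm]
      refine (totalDegree_mul _ _).trans (add_le_add hVdeg ?_)
      refine (totalDegree_finsetProd _ _).trans ?_
      rw [Finset.card_eq_sum_ones]
      refine Finset.sum_le_sum fun e _ => ?_
      refine (totalDegree_sub _ _).trans ?_
      simp only [totalDegree_C, max_le_iff, zero_le, and_true]
      exact totalDegree_finsetSum_le fun i _ => by simp
    · have := le_totalDegree (mem_support_iff.2 hcoeff)
      rwa [Finsupp.sum, ← Finsupp.degree_apply] at this
  obtain ⟨x, hxB, hx⟩ := combinatorial_nullstellensatz_exists_eval_nonzero F t hcoeff hdeg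
    (fun _ => B) hlt
  rw [hF, map_mul, map_prod] at hx
  have hx1 := left_ne_zero_of_mul hx
  have hx2 := right_ne_zero_of_mul hx
  have hxinj : Function.Injective x := by
    rw [← Matrix.det_vandermonde_ne_zero_iff]
    convert hx1
    rw [hV, RingHom.map_det]
    congr 1
    ext i j
    simp [Matrix.vandermonde_apply]
  rw [Finset.prod_ne_zero_iff] at hx2
  refine hx2 (∑ i, x i) (hE ?_) (by simp)
  rw [kSums, Finset.mem_image]
  refine ⟨univ.image x, ?_, ?_⟩
  · rw [Finset.mem_powersetCard, Finset.card_image_of_injective _ hxinj]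
    refine ⟨?_, by simp⟩
    intro y hy
    obtain ⟨i, -, rfl⟩ := Finset.mem_image.1 hy
    exact hxB i
  · rw [Finset.sum_image (fun i _ j _ h => hxinj h)]

lemma exists_injective_sum_eq (k w N : ℕ) (hN : N ≤ k * w) :
    ∃ c : Fin k → ℕ, Function.Injective c ∧ (∀ i, c i < w + k) ∧
      ∑ i, c i = N + ∑ i : Fin k, (i : ℕ) := by
  induction k generalizing N with
  | zero => exact ⟨fun i => 0, fun i => i.elim0, fun i => i.elim0, by simp at *; omega⟩
  | succ k ih =>
    obtain ⟨c, hinj, hlt, hsum⟩ := ih (N - w) (by rw [Nat.succ_mul] at hN; omega)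
    rcases le_total N w with h | h
    · refine ⟨Fin.snoc (fun i : Fin k => (i : ℕ)) (k + N), ?_, ?_, ?_⟩
      · rw [Fin.snoc_injective_iff]
        refine ⟨Fin.val_injective, ?_⟩
        rintro ⟨i, hi⟩
        have := i.2
        simp at hi
        omega
      · intro i
        refine Fin.lastCases ?_ (fun i => ?_) i
        · simp; omega
        · simp; omega
      · rw [Fin.sum_univ_castSucc, Fin.sum_univ_castSucc]
        simp
        omega
    · refine ⟨Fin.snoc c (k + w), ?_, ?_, ?_⟩
      · rw [Fin.snoc_injective_iff]
        refine ⟨hinj, ?_⟩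
        rintro ⟨i, hi⟩
        have := hlt i
        omega
      · intro i
        refine Fin.lastCases ?_ (fun i => ?_) i
        · simp; omega
        · have := hlt i
          simp; omega
      · rw [Fin.sum_univ_castSucc, Fin.sum_univ_castSucc]
        simp
        omega

/-- The Dias da Silva–Hamidoune theorem. -/
theorem min_le_card_kSums {q : ℕ} [Fact q.Prime] {k : ℕ} (B : Finset (ZMod q)) (hk : k ≤ #B) :
    min q (k * (#B - k) + 1) ≤ #(kSums k B) := by
  have hq : q.Prime := Fact.out
  have hpos := hq.pos
  obtain ⟨c, hinj, hlt, hsum⟩ := exists_injective_sum_eq k (#B - k)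
    (min (q - 1) (k * (#B - k))) (min_le_right _ _)
  have := lt_card_kSums_of_injective B c hinj (fun i => by have := hlt i; omega) (by omega) hsum
  omega

end DiasDaSilvaHamidoune

section CauchyDavenport

open scoped Pointwise

variable {r : ℕ} [Fact r.Prime]

lemma min_le_card_sum_pointwise {ι : Type*} (s : Finset ι) (S : ι → Finset (ZMod r)) (f : ι → ℕ)
    (h : ∀ i ∈ s, min r (f i + 1) ≤ #(S i)) : min r (1 + ∑ i ∈ s, f i) ≤ #(∑ i ∈ s, S i) := by
  classical
  have hr : r.Prime := Fact.out
  have hpos := hr.pos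
  induction s using Finset.induction_on with
  | empty => simp
  | insert a s ha ih =>
    rw [Finset.sum_insert ha, Finset.sum_insert ha]
    have h1 := ih fun i hi => h i (Finset.mem_insert_of_mem hi)
    have h2 := h a (Finset.mem_insert_self a s)
    have := ZMod.cauchy_davenport hr (s := S a) (t := ∑ i ∈ s, S i)
      (Finset.card_pos.1 (by omega)) (Finset.card_pos.1 (by omega))
    omega

lemma exists_sum_eq_of_le {ι : Type*} (s : Finset ι) (S : ι → Finset (ZMod r)) (f : ι → ℕ)
    (h : ∀ i ∈ s, min r (f i + 1) ≤ #(S i)) (hf : r ≤ 1 + ∑ i ∈ s, f i) (d : ZMod r) :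
    ∃ x : ι → ZMod r, (∀ i ∈ s, x i ∈ S i) ∧ ∑ i ∈ s, x i = d := by
  have h1 := min_le_card_sum_pointwise s S f h
  rw [min_eq_left hf] at h1
  have h2 : ∑ i ∈ s, S i = univ := by
    rw [← Finset.card_eq_iff_eq_univ, ZMod.card]
    refine le_antisymm ?_ h1
    simpa [ZMod.card] using Finset.card_le_univ (∑ i ∈ s, S i)
  have h3 : d ∈ ((∑ i ∈ s, S i : Finset (ZMod r)) : Set (ZMod r)) := by simp [h2]
  rw [Finset.coe_sum, Set.mem_finsetSum] at h3
  obtain ⟨g, hg, hd⟩ := h3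
  exact ⟨g, fun i hi => by simpa using hg hi, hd⟩

lemma min_le_card_image_Icc_mul {i : ZMod r} (hi : i ≠ 0) {a b : ℕ} (hab : a ≤ b) :
    min r (b - a + 1) ≤ #((Icc a b).image fun k : ℕ => (k : ZMod r) * i) := by
  set m := min r (b - a + 1) with hm
  have hinj : Set.InjOn (fun k : ℕ => (k : ZMod r) * i) (Ico a (a + m)) := by
    intro x hx y hy hxy
    have hx := Finset.mem_Ico.1 hx
    have hy := Finset.mem_Ico.1 hy
    have h1 : (x : ZMod r) = y := mul_right_cancel₀ hi hxy
    rw [ZMod.natCast_eq_natCast_iff] at h1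
    rcases le_total x y with h | h
    · have := (Nat.modEq_iff_dvd' h).1 h1
      have := Nat.eq_zero_of_dvd_of_lt this (by omega)
      omega
    · have := (Nat.modEq_iff_dvd' h).1 h1.symm
      have := Nat.eq_zero_of_dvd_of_lt this (by omega)
      omega
  calc m = #(Ico a (a + m)) := by simp
    _ = #((Ico a (a + m)).image fun k : ℕ => (k : ZMod r) * i) :=
      (Finset.card_image_of_injOn hinj).symm
    _ ≤ _ := Finset.card_le_card (Finset.image_subset_image fun x hx => by
      simp only [Finset.mem_Ico, Finset.mem_Icc] at *
      omega)

lemma exists_multiplicities (s : Finset (ZMod r)) (hs : 0 ∉ s) (lo hi : ZMod r → ℕ)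
    (hle : ∀ i ∈ s, lo i ≤ hi i) (hsum : r ≤ 1 + ∑ i ∈ s, (hi i - lo i)) (c : ZMod r) :
    ∃ k : ZMod r → ℕ, (∀ i ∈ s, lo i ≤ k i ∧ k i ≤ hi i) ∧ ∑ i ∈ s, (k i : ZMod r) * i = c := by
  obtain ⟨x, hx, hc⟩ := exists_sum_eq_of_le s
    (fun i => (Icc (lo i) (hi i)).image fun k : ℕ => (k : ZMod r) * i) (fun i => hi i - lo i)
    (fun i his => min_le_card_image_Icc_mul (fun h0 => hs (h0 ▸ his)) (hle i his)) hsum c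
  have hx' : ∀ i, ∃ k : ℕ, i ∈ s → (lo i ≤ k ∧ k ≤ hi i) ∧ (k : ZMod r) * i = x i := by
    intro i
    by_cases his : i ∈ s
    · obtain ⟨k, hk, hkx⟩ := Finset.mem_image.1 (hx i his)
      exact ⟨k, fun _ => ⟨Finset.mem_Icc.1 hk, hkx⟩⟩
    · exact ⟨0, fun h => absurd h his⟩
  choose k hk using hx'
  exact ⟨k, fun i his => (hk i his).1, by
    rw [← hc]; exact Finset.sum_congr rfl fun i his => (hk i his).2⟩

lemma card_four_sums {r : ℕ} {a b : ZMod r} (ha : a ≠ 0) (hb : b ≠ 0) (hab : a ≠ b)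
    (hab' : a + b ≠ 0) : #({0, a, b, a + b} : Finset (ZMod r)) = 4 := by
  rw [Finset.card_insert_of_notMem, Finset.card_insert_of_notMem, Finset.card_insert_of_notMem,
    Finset.card_singleton]
  · simp [ha]
  · simp [hab, hb]
  · simp [ha.symm, hb.symm, hab'.symm]

lemma exists_multiplicities_of_ne (s : Finset (ZMod r)) (hs : 0 ∉ s) (lo hi : ZMod r → ℕ)
    (hle : ∀ i ∈ s, lo i ≤ hi i) (hsum : r ≤ 2 + ∑ i ∈ s, (hi i - lo i)) {a b : ZMod r}
    (ha : a ∈ s) (hb : b ∈ s) (hab : a ≠ b) (hab' : a + b ≠ 0) (hla : lo a < hi a)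
    (hlb : lo b < hi b) (c : ZMod r) :
    ∃ k : ZMod r → ℕ, (∀ i ∈ s, lo i ≤ k i ∧ k i ≤ hi i) ∧ ∑ i ∈ s, (k i : ZMod r) * i = c := by
  have ha0 : a ≠ 0 := fun h => hs (h ▸ ha)
  have hb0 : b ≠ 0 := fun h => hs (h ▸ hb)
  set hi' : ZMod r → ℕ := fun i => if i = a ∨ i = b then hi i - 1 else hi i with hhi'
  have hle' : ∀ i ∈ s, lo i ≤ hi' i := by
    intro i his
    have := hle i his
    simp only [hhi']
    split_ifs with h
    · rcases h with rfl | rfl <;> omega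
    · exact this
  have hsub : ({a, b} : Finset (ZMod r)) ⊆ s := by
    intro x hx
    rcases (by simpa using hx : x = a ∨ x = b) with rfl | rfl <;> assumption
  have hsum' : ∑ i ∈ s, (hi i - lo i) = ∑ i ∈ s, (hi' i - lo i) + 2 := by
    have h2 : (2 : ℕ) = ∑ i ∈ s, if i = a ∨ i = b then 1 else 0 := by
      rw [Finset.sum_ite, Finset.sum_const_zero, add_zero, Finset.sum_const, smul_eq_mul, mul_one]
      rw [show s.filter (fun i => i = a ∨ i = b) = {a, b} by
        ext x
        simp only [Finset.mem_filter, Finset.mem_insert, Finset.mem_singleton]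
        exact ⟨fun h => h.2, fun h => ⟨hsub (by simpa using h), h⟩⟩]
      rw [Finset.card_pair hab]
    rw [h2, ← Finset.sum_add_distrib]
    refine Finset.sum_congr rfl fun i his => ?_
    have := hle' i his
    simp only [hhi'] at this ⊢
    split_ifs with h
    · rcases h with rfl | rfl <;> omega
    · omega
  let S : Option (ZMod r) → Finset (ZMod r) := fun o => o.elim {0, a, b, a + b}
    fun i => (Icc (lo i) (hi' i)).image fun k : ℕ => (k : ZMod r) * i
  let f : Option (ZMod r) → ℕ := fun o => o.elim 3 fun i => hi' i - lo i
  obtain ⟨x, hx, hc⟩ := exists_sum_eq_of_le (Finset.insertNone s) S f (by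
    intro o ho
    cases o with
    | none =>
      refine (min_le_right _ _).trans ?_
      exact (card_four_sums ha0 hb0 hab hab').ge
    | some i =>
      have his : i ∈ s := by simpa using ho
      exact min_le_card_image_Icc_mul (fun h0 => hs (h0 ▸ his)) (hle' i his)) (by
    rw [Finset.sum_insertNone]
    simp only [f, Option.elim]
    omega) c
  rw [Finset.sum_insertNone] at hc
  have hx' : ∀ i, ∃ k : ℕ, i ∈ s → (lo i ≤ k ∧ k ≤ hi' i) ∧ (k : ZMod r) * i = x (some i) := by
    intro i
    by_cases his : i ∈ s
    · obtain ⟨k, hk, hkx⟩ := Finset.mem_image.1 (hx (some i) (by simpa using his))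
      exact ⟨k, fun _ => ⟨Finset.mem_Icc.1 hk, hkx⟩⟩
    · exact ⟨0, fun h => absurd h his⟩
  choose k hk using hx'
  have hnone : ∃ u v : ℕ, u ≤ 1 ∧ v ≤ 1 ∧ x none = u * a + v * b := by
    have h0 := hx none (by simp)
    simp only [S, Option.elim, Finset.mem_insert, Finset.mem_singleton] at h0
    rcases h0 with h | h | h | h
    · exact ⟨0, 0, by omega, by omega, by simp [h]⟩
    · exact ⟨1, 0, by omega, by omega, by simp [h]⟩
    · exact ⟨0, 1, by omega, by omega, by simp [h]⟩
    · exact ⟨1, 1, by omega, by omega, by simp [h]⟩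
  obtain ⟨u, v, hu, hv, huv⟩ := hnone
  refine ⟨fun i => k i + (if i = a then u else 0) + (if i = b then v else 0), ?_, ?_⟩
  · intro i his
    have h1 := (hk i his).1
    simp only [hhi'] at h1 ⊢
    by_cases hia : i = a
    · subst hia
      simp only [true_or, if_true, if_neg hab] at h1 ⊢
      omega
    · by_cases hib : i = b
      · subst hib
        simp only [or_true, if_true, if_neg hia] at h1 ⊢
        omega
      · simp only [hia, hib, or_self, if_false] at h1 ⊢
        omega
  · rw [← hc, huv]
    push_cast
    simp only [add_mul, Finset.sum_add_distrib, ite_mul, zero_mul, Finset.sum_ite_eq', ha, hb,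
      if_true]
    rw [Finset.sum_congr rfl fun i his => (hk i his).2]
    ring

/-- The set of sums of all subsets of `B`, including the empty one. -/
def subsetSums {R : Type*} [AddCommMonoid R] [DecidableEq R] (B : Finset R) : Finset R :=
  B.powerset.image fun T => ∑ x ∈ T, x

lemma card_subsetSums_union {B C : Finset (ZMod r)} (h : Disjoint B C) :
    min r (#(subsetSums B) + #(subsetSums C) - 1) ≤ #(subsetSums (B ∪ C)) := by
  have hne : ∀ B : Finset (ZMod r), (subsetSums B).Nonempty := fun B =>
    ⟨0, Finset.mem_image.2 ⟨∅, by simp, by simp⟩⟩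
  refine (ZMod.cauchy_davenport Fact.out (hne B) (hne C)).trans (Finset.card_le_card ?_)
  intro x hx
  obtain ⟨y, hy, z, hz, rfl⟩ := Finset.mem_add.1 hx
  obtain ⟨T, hT, rfl⟩ := Finset.mem_image.1 hy
  obtain ⟨U, hU, rfl⟩ := Finset.mem_image.1 hz
  rw [Finset.mem_powerset] at hT hU
  refine Finset.mem_image.2 ⟨T ∪ U, Finset.mem_powerset.2 (Finset.union_subset_union hT hU), ?_⟩
  exact Finset.sum_union (Finset.disjoint_of_subset_left hT (Finset.disjoint_of_subset_right hU h))

lemma two_le_card_subsetSums_singleton {a : ZMod r} (ha : a ≠ 0) : 2 ≤ #(subsetSums {a}) := by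
  rw [← Finset.card_pair ha]
  refine Finset.card_le_card fun x hx => ?_
  rcases (by simpa using hx : x = a ∨ x = 0) with rfl | rfl
  · exact Finset.mem_image.2 ⟨{x}, by simp, by simp⟩
  · exact Finset.mem_image.2 ⟨∅, by simp, by simp⟩

lemma four_le_card_subsetSums_pair {a b : ZMod r} (ha : a ≠ 0) (hb : b ≠ 0) (hab : a ≠ b)
    (hab' : a + b ≠ 0) : 4 ≤ #(subsetSums {a, b}) := by
  rw [← card_four_sums ha hb hab hab']
  refine Finset.card_le_card fun x hx => ?_
  simp only [Finset.mem_insert, Finset.mem_singleton] at hx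
  refine Finset.mem_image.2 ?_
  rcases hx with rfl | rfl | rfl | rfl
  · exact ⟨∅, by simp, by simp⟩
  · exact ⟨{x}, by simp, by simp⟩
  · exact ⟨{x}, by simp, by simp⟩
  · exact ⟨{a, b}, by simp, by rw [Finset.sum_pair hab]⟩

lemma min_le_card_subsetSums (B : Finset (ZMod r)) (hB : 0 ∉ B) :
    min r (1 + #B) ≤ #(subsetSums B) := by
  induction B using Finset.induction_on with
  | empty =>
    refine (min_le_right _ _).trans ?_
    exact Finset.card_pos.2 ⟨0, Finset.mem_image.2 ⟨∅, by simp, by simp⟩⟩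
  | insert a B ha ih =>
    rw [Finset.mem_insert, not_or] at hB
    have h1 := ih hB.2
    have h2 := two_le_card_subsetSums_singleton (Ne.symm hB.1)
    have h3 := card_subsetSums_union (B := {a}) (C := B) (by simpa using ha)
    rw [Finset.card_insert_of_notMem ha, Finset.insert_eq]
    omega

lemma exists_ne_add_ne_zero {B : Finset (ZMod r)} (h3 : 3 ≤ #B) :
    ∃ a ∈ B, ∃ b ∈ B, a ≠ b ∧ a + b ≠ 0 := by
  obtain ⟨a, ha, b, hb, c, hc, hab, hac, hbc⟩ := Finset.two_lt_card.1 (by omega : 2 < #B)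
  by_cases h : a + b = 0
  · refine ⟨a, ha, c, hc, hac, fun h' => hbc ?_⟩
    exact add_left_cancel (h.trans h'.symm)
  · exact ⟨a, ha, b, hb, hab, h⟩

lemma min_le_card_subsetSums_of_three_le (B : Finset (ZMod r)) (hB : 0 ∉ B) (h3 : 3 ≤ #B) :
    min r (1 + #B + #B / 2) ≤ #(subsetSums B) := by
  have step : ∀ (B : Finset (ZMod r)) (a b : ZMod r) (n : ℕ), 0 ∉ B → a ∈ B → b ∈ B → a ≠ b →
      a + b ≠ 0 → min r (1 + n) ≤ #(subsetSums ((B.erase a).erase b)) →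
      min r (1 + (n + 3)) ≤ #(subsetSums B) := by
    intro B a b n h0 ha hb hab hab' h
    have hU : {a, b} ∪ (B.erase a).erase b = B := by
      ext x
      simp only [Finset.mem_union, Finset.mem_insert, Finset.mem_singleton, Finset.mem_erase]
      constructor
      · rintro ((rfl | rfl) | h)
        · exact ha
        · exact hb
        · exact h.2.2
      · tauto
    have h1 := card_subsetSums_union (B := {a, b}) (C := (B.erase a).erase b) (by
      rw [Finset.disjoint_left]
      intro x hx
      rcases (by simpa using hx : x = a ∨ x = b) with rfl | rfl <;> simp)
    have h2 := four_le_card_subsetSums_pair (a := a) (b := b) (fun h => h0 (h ▸ ha))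
      (fun h => h0 (h ▸ hb)) hab hab'
    rw [hU] at h1
    omega
  induction hn : #B using Nat.strong_induction_on generalizing B with
  | _ n ih =>
    subst hn
    by_cases h4 : #B = 4
    · obtain ⟨a, ha⟩ : B.Nonempty := Finset.card_pos.1 (by omega)
      have hcard : #((B.erase a).erase (-a)) ≥ 2 := by
        have h1 := Finset.card_erase_of_mem ha
        have h2 := Finset.pred_card_le_card_erase (s := B.erase a) (a := -a)
        omega
      obtain ⟨b, hb, c, hc, hbc⟩ := Finset.one_lt_card.1 (by omega : 1 < #((B.erase a).erase (-a)))
      simp only [Finset.mem_erase] at hb hc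
      obtain ⟨x, hx, hxa, hxB, hrest⟩ : ∃ x, x ≠ -a ∧ x ≠ a ∧ x ∈ B ∧
          ∃ y ∈ (B.erase a).erase x, ∃ z ∈ (B.erase a).erase x, y ≠ z ∧ y + z ≠ 0 := by
        obtain ⟨e, he⟩ : (((B.erase a).erase b).erase c).Nonempty := by
          apply Finset.card_pos.1
          rw [Finset.card_erase_of_mem, Finset.card_erase_of_mem, Finset.card_erase_of_mem ha, h4]
          · norm_num
          · simp [hb]
          · simp [hc, hbc.symm]
        simp only [Finset.mem_erase] at he
        by_cases hce : c + e = 0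
        · refine ⟨c, hc.1, hc.2.1, hc.2.2, b, by simp [hbc, hb], e, by simp [he], Ne.symm he.2.1,
            fun h => hbc ?_⟩
          exact add_right_cancel (h.trans hce.symm)
        · exact ⟨b, hb.1, hb.2.1, hb.2.2, c, by simp [hbc.symm, hc], e, by simp [he],
            Ne.symm he.1, hce⟩
      obtain ⟨y, hy, z, hz, hyz, hyz'⟩ := hrest
      have h0 : 0 ∉ (B.erase a).erase x := fun h =>
        hB (Finset.mem_of_mem_erase (Finset.mem_of_mem_erase h))
      have h1 := step ((B.erase a).erase x) y z 0 h0 hy hz hyz hyz' (by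
        refine (min_le_right _ _).trans ?_
        exact Finset.card_pos.2 ⟨0, Finset.mem_image.2 ⟨∅, by simp, by simp⟩⟩)
      have h2 := step B a x (0 + 3) hB ha hxB hxa.symm
        (fun h => hx (eq_neg_of_add_eq_zero_right h)) h1
      rw [h4]
      exact h2
    · obtain ⟨a, ha, b, hb, hab, hab'⟩ := exists_ne_add_ne_zero h3
      have h0 : 0 ∉ (B.erase a).erase b := fun h =>
        hB (Finset.mem_of_mem_erase (Finset.mem_of_mem_erase h))
      have hcard : #((B.erase a).erase b) = #B - 2 := by
        rw [Finset.card_erase_of_mem (by simp [hab.symm, hb]), Finset.card_erase_of_mem ha]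
        omega
      by_cases h5 : #B = 3
      · have h1 := min_le_card_subsetSums _ h0
        rw [hcard] at h1
        have := step B a b _ hB ha hb hab hab' h1
        rw [h5] at this ⊢
        exact this
      · have h1 := ih (#B - 2) (by omega) _ h0 (by omega) hcard
        rw [add_assoc] at h1
        have := step B a b _ hB ha hb hab hab' h1
        omega

end CauchyDavenport

section Covers

variable {p q : ℕ} [Fact p.Prime] [Fact q.Prime]

/-- Viewing `B` as the family of fibres over `ZMod p` of a subset of `ZMod p × ZMod q`, every
element of `ZMod p × ZMod q` is a nonempty subset sum. -/
def Covers (B : ZMod p → Finset (ZMod q)) : Prop :=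
  ∀ (c : ZMod p) (d : ZMod q), ∃ T : ZMod p → Finset (ZMod q), (∀ i, T i ⊆ B i) ∧
    (∃ i, (T i).Nonempty) ∧ ∑ i, (#(T i) : ZMod p) * i = c ∧ ∑ i, ∑ x ∈ T i, x = d

lemma exists_cover (B : ZMod p → Finset (ZMod q)) (C : Finset (Finset (ZMod q)))
    (lo hi f : ZMod p → ℕ) (φ : ℕ)
    (hC : min q (φ + 1) ≤ #(C.image fun T => ∑ x ∈ T, x))
    (hf : ∀ i ≠ 0, ∀ k, lo i ≤ k → k ≤ hi i → min q (f i + 1) ≤ #(kSums k (B i)))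
    (hfill : q ≤ 1 + φ + ∑ i ∈ univ.erase 0, f i)
    (hcov : ∀ c, ∃ k : ZMod p → ℕ, (∀ i ∈ univ.erase 0, lo i ≤ k i ∧ k i ≤ hi i) ∧
      ∑ i ∈ univ.erase 0, (k i : ZMod p) * i = c) (c : ZMod p) (d : ZMod q) :
    ∃ T : ZMod p → Finset (ZMod q), T 0 ∈ C ∧ (∀ i ≠ 0, T i ⊆ B i ∧ lo i ≤ #(T i)) ∧
      ∑ i, (#(T i) : ZMod p) * i = c ∧ ∑ i, ∑ x ∈ T i, x = d := by
  obtain ⟨k, hk, hkc⟩ := hcov c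
  simp only [Finset.mem_erase, Finset.mem_univ, and_true] at hk
  let F : ZMod p → Finset (Finset (ZMod q)) := fun i => if i = 0 then C else (B i).powersetCard (k i)
  obtain ⟨x, hx, hxd⟩ := exists_sum_eq_of_le univ (fun i => (F i).image fun T => ∑ x ∈ T, x)
    (fun i => if i = 0 then φ else f i) (by
      intro i _
      by_cases h : i = 0
      · simpa [F, h] using hC
      · simpa [F, h, kSums] using hf i h (k i) (hk i h).1 (hk i h).2) (by
      rw [← Finset.add_sum_erase _ _ (mem_univ (0 : ZMod p)), if_pos rfl, ← add_assoc]
      rwa [Finset.sum_congr rfl fun i hi => if_neg (Finset.ne_of_mem_erase hi)]) d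
  have hx' : ∀ i, ∃ T ∈ F i, ∑ x ∈ T, x = x i := fun i => by
    simpa using hx i (mem_univ i)
  choose T hT hTx using hx'
  have hT' : ∀ i ≠ 0, T i ⊆ B i ∧ #(T i) = k i := fun i h => by
    have := hT i
    simp only [F, if_neg h] at this
    exact Finset.mem_powersetCard.1 this
  refine ⟨T, by simpa [F] using hT 0, fun i h => ⟨(hT' i h).1, ?_⟩, ?_, ?_⟩
  · rw [(hT' i h).2]
    exact (hk i h).1
  · rw [← hkc, ← Finset.add_sum_erase _ _ (mem_univ (0 : ZMod p)), mul_zero, zero_add]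
    refine Finset.sum_congr rfl fun i hi => ?_
    rw [(hT' i (Finset.ne_of_mem_erase hi)).2]
  · rw [← hxd]
    exact Finset.sum_congr rfl fun i _ => hTx i

lemma covers_of_fill (B : ZMod p → Finset (ZMod q)) (t : ZMod p → ℕ) (φ : ℕ)
    (ht : ∀ i ≠ 0, 2 * t i ≤ #(B i)) (hpos : ∃ i, i ≠ 0 ∧ 0 < t i)
    (hφ : min q (φ + 1) ≤ #(subsetSums (B 0)))
    (hcov : ∀ c, ∃ k : ZMod p → ℕ, (∀ i ∈ univ.erase 0, t i ≤ k i ∧ k i ≤ #(B i) - t i) ∧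
      ∑ i ∈ univ.erase 0, (k i : ZMod p) * i = c)
    (hfill : q ≤ 1 + φ + ∑ i ∈ univ.erase 0, t i * (#(B i) - t i)) : Covers B := by
  intro c d
  obtain ⟨T, hT0, hT, hc, hd⟩ := exists_cover B (B 0).powerset t (fun i => #(B i) - t i)
    (fun i => t i * (#(B i) - t i)) φ hφ (by
      intro i hi k hk1 hk2
      refine le_trans ?_ (min_le_card_kSums (B i) (hk2.trans (Nat.sub_le _ _)))
      have h2 := ht i hi
      refine min_le_min le_rfl (Nat.add_le_add_right ?_ 1)
      obtain ⟨u, rfl⟩ := Nat.exists_eq_add_of_le hk1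
      obtain ⟨v, hv⟩ := Nat.exists_eq_add_of_le hk2
      have h3 : #(B i) = 2 * t i + u + v := by omega
      rw [h3, show 2 * t i + u + v - t i = t i + u + v by omega,
        show 2 * t i + u + v - (t i + u) = t i + v by omega]
      nlinarith [Nat.zero_le (u * v)]) hfill hcov c d
  refine ⟨T, fun i => ?_, ?_, hc, hd⟩
  · by_cases h : i = 0
    · subst h
      exact Finset.mem_powerset.1 hT0
    · exact (hT i h).1
  · obtain ⟨i, hi, h0⟩ := hpos
    exact ⟨i, Finset.card_pos.1 (h0.trans_le (hT i hi).2)⟩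

lemma exists_multiplicities_erase (m t : ZMod p → ℕ) (ht : ∀ i ≠ 0, 2 * t i ≤ m i)
    (h : p + 2 * ∑ i ∈ univ.erase 0, t i ≤ 1 + ∑ i ∈ univ.erase 0, m i) (c : ZMod p) :
    ∃ k : ZMod p → ℕ, (∀ i ∈ univ.erase 0, t i ≤ k i ∧ k i ≤ m i - t i) ∧
      ∑ i ∈ univ.erase 0, (k i : ZMod p) * i = c := by
  have ht' : ∀ i ∈ univ.erase (0 : ZMod p), 2 * t i ≤ m i := fun i hi =>
    ht i (Finset.ne_of_mem_erase hi)
  refine exists_multiplicities _ (by simp) t _ (fun i hi => by have := ht' i hi; omega) ?_ c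
  have h1 : ∑ i ∈ univ.erase 0, (m i - t i - t i) + 2 * ∑ i ∈ univ.erase 0, t i =
      ∑ i ∈ univ.erase 0, m i := by
    rw [Finset.mul_sum, ← Finset.sum_add_distrib]
    exact Finset.sum_congr rfl fun i hi => by have := ht' i hi; omega
  omega

lemma exists_multiplicities_erase_of_ne (m t : ZMod p → ℕ) (ht : ∀ i ≠ 0, 2 * t i ≤ m i)
    (h : p + 2 * ∑ i ∈ univ.erase 0, t i ≤ 2 + ∑ i ∈ univ.erase 0, m i) {a b : ZMod p}
    (ha : a ≠ 0) (hb : b ≠ 0) (hab : a ≠ b) (hab' : a + b ≠ 0) (hta : 2 * t a < m a)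
    (htb : 2 * t b < m b) (c : ZMod p) :
    ∃ k : ZMod p → ℕ, (∀ i ∈ univ.erase 0, t i ≤ k i ∧ k i ≤ m i - t i) ∧
      ∑ i ∈ univ.erase 0, (k i : ZMod p) * i = c := by
  have ht' : ∀ i ∈ univ.erase (0 : ZMod p), 2 * t i ≤ m i := fun i hi =>
    ht i (Finset.ne_of_mem_erase hi)
  refine exists_multiplicities_of_ne _ (by simp) t _ (fun i hi => by have := ht' i hi; omega) ?_
    (by simpa using ha) (by simpa using hb) hab hab' (by omega) (by omega) c
  have h1 : ∑ i ∈ univ.erase 0, (m i - t i - t i) + 2 * ∑ i ∈ univ.erase 0, t i =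
      ∑ i ∈ univ.erase 0, m i := by
    rw [Finset.mul_sum, ← Finset.sum_add_distrib]
    exact Finset.sum_congr rfl fun i hi => by have := ht' i hi; omega
  omega

/-- If the fibre over `0` has all elements of `ZMod q` as nonempty subset sums, it is enough to
choose the first coordinate. -/
lemma covers_of_card_zero_fibre (B : ZMod p → Finset (ZMod q)) (hB : 0 ∉ B 0) (hq : 11 ≤ q)
    (h0 : q - 3 ≤ #(B 0))
    (hcov : ∀ c, ∃ k : ZMod p → ℕ, (∀ i ∈ univ.erase 0, 0 ≤ k i ∧ k i ≤ #(B i)) ∧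
      ∑ i ∈ univ.erase 0, (k i : ZMod p) * i = c) : Covers B := by
  intro c d
  obtain ⟨T, hT0, hT, hc, hd⟩ := exists_cover B ((B 0).powerset.erase ∅) (fun _ => 0)
    (fun i => #(B i)) (fun _ => 0) (q - 1) (by
      obtain ⟨a, ha⟩ : (B 0).Nonempty := Finset.card_pos.1 (by omega)
      have h1 := min_le_card_subsetSums_of_three_le ((B 0).erase a)
        (fun h => hB (Finset.mem_of_mem_erase h)) (by rw [Finset.card_erase_of_mem ha]; omega)
      rw [Finset.card_erase_of_mem ha] at h1
      have h2 : #((subsetSums ((B 0).erase a)).image fun x => a + x) =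
          #(subsetSums ((B 0).erase a)) :=
        Finset.card_image_of_injective _ (add_right_injective a)
      have h3 : (subsetSums ((B 0).erase a)).image (fun x => a + x) ⊆
          ((B 0).powerset.erase ∅).image fun T => ∑ x ∈ T, x := by
        intro y hy
        obtain ⟨x, hx, rfl⟩ := Finset.mem_image.1 hy
        obtain ⟨U, hU, rfl⟩ := Finset.mem_image.1 hx
        rw [Finset.mem_powerset] at hU
        have haU : a ∉ U := fun h => by simpa using hU h
        refine Finset.mem_image.2 ⟨insert a U, ?_, Finset.sum_insert haU⟩
        rw [Finset.mem_erase, Finset.mem_powerset]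
        exact ⟨Finset.insert_ne_empty _ _, Finset.insert_subset ha
          (hU.trans (Finset.erase_subset _ _))⟩
      have h4 := Finset.card_le_card h3
      omega) (by
      intro i _ k _ hk
      refine le_trans ?_ (min_le_card_kSums (B i) hk)
      exact min_le_min le_rfl (by omega)) (by omega) hcov c d
  rw [Finset.mem_erase, Finset.mem_powerset] at hT0
  refine ⟨T, fun i => ?_, ⟨0, Finset.nonempty_iff_ne_empty.2 hT0.1⟩, hc, hd⟩
  by_cases h : i = 0
  · subst h
    exact hT0.2
  · exact (hT i h).1

lemma card_univ_erase_zero : #(univ.erase (0 : ZMod p)) = p - 1 := by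
  rw [Finset.card_erase_of_mem (mem_univ _), Finset.card_univ, ZMod.card]

lemma covers_of_subset (B : ZMod p → Finset (ZMod q)) (K : Finset (ZMod p)) (φ : ℕ)
    (h0 : 0 ∉ K) (hK : ∀ i ∈ K, 2 ≤ #(B i)) (hne : K.Nonempty)
    (hφ : min q (φ + 1) ≤ #(subsetSums (B 0)))
    (hgrow : p + 2 * #K ≤ 1 + ∑ i ∈ univ.erase 0, #(B i))
    (hfill : q ≤ 1 + φ + ∑ i ∈ K, (#(B i) - 1)) : Covers B := by
  have hsub : K ⊆ univ.erase 0 := fun i hi => by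
    simpa using fun h : i = 0 => h0 (h ▸ hi)
  have ht : ∀ i ≠ 0, 2 * (if i ∈ K then 1 else 0) ≤ #(B i) := fun i _ => by
    split_ifs with h
    · simpa using hK i h
    · simp
  refine covers_of_fill B (fun i => if i ∈ K then 1 else 0) φ ht ?_ hφ
    (exists_multiplicities_erase _ _ ht ?_) ?_
  · obtain ⟨i, hi⟩ := hne
    exact ⟨i, fun h => h0 (h ▸ hi), by simp [hi]⟩
  · rw [Finset.sum_ite_mem, Finset.inter_eq_right.2 hsub]
    simpa using hgrow
  · have : ∑ i ∈ univ.erase 0, (if i ∈ K then 1 else 0) * (#(B i) - if i ∈ K then 1 else 0) =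
        ∑ i ∈ K, (#(B i) - 1) := by
      rw [← Finset.sum_subset hsub]
      · exact Finset.sum_congr rfl fun i hi => by simp [hi]
      · intro i _ hi
        simp [hi]
    rw [this]
    exact hfill

lemma sum_tsub_add_mul_card {ι : Type*} (s : Finset ι) (m : ι → ℕ) (a : ℕ)
    (h : ∀ i ∈ s, a ≤ m i) : ∑ i ∈ s, (m i - a) + a * #s = ∑ i ∈ s, m i := by
  rw [mul_comm, ← smul_eq_mul, ← Finset.sum_const, ← Finset.sum_add_distrib]
  exact Finset.sum_congr rfl fun i hi => Nat.sub_add_cancel (h i hi)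

lemma sum_le_sum_tsub_add_mul_card {ι : Type*} (s : Finset ι) (m : ι → ℕ) (a : ℕ) :
    ∑ i ∈ s, m i ≤ ∑ i ∈ s, (m i - a) + a * #s := by
  rw [mul_comm, ← smul_eq_mul, ← Finset.sum_const, ← Finset.sum_add_distrib]
  exact Finset.sum_le_sum fun i hi => by omega

lemma sum_filter_tsub {ι : Type*} (s : Finset ι) (m : ι → ℕ) (a : ℕ) :
    ∑ i ∈ s with a < m i, (m i - a) = ∑ i ∈ s, (m i - a) := by
  refine Finset.sum_subset (Finset.filter_subset _ _) fun i hi h => ?_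
  simp only [Finset.mem_filter, not_and, not_lt] at h
  have := h hi
  omega

lemma covers_of_three_le (B : ZMod p → Finset (ZMod q)) (hB : 0 ∉ B 0) (hodd : q % 2 = 1)
    (hpq : 2 * p + 3 ≤ q) (hp : 3 ≤ p) (hm : #(B 0) + ∑ i ∈ univ.erase 0, #(B i) = p + q - 3)
    (h3 : 3 ≤ #(B 0)) (h4 : #(B 0) ≤ q - 4) : Covers B := by
  set s := univ.erase (0 : ZMod p) with hs
  have hcs : #s = p - 1 := card_univ_erase_zero
  set N := ∑ i ∈ s, #(B i) with hN
  set e := (q - 2 - #(B 0)) / 2 with he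
  have hφ := min_le_card_subsetSums_of_three_le (B 0) hB h3
  set M := s.filter fun i => 2 < #(B i) with hM
  set L := s.filter fun i => 1 < #(B i) with hL
  have hML : M ⊆ L := fun i hi => by
    simp only [hM, hL, Finset.mem_filter] at hi ⊢
    exact ⟨hi.1, by omega⟩
  have hL0 : 0 ∉ L := fun h => by
    simp [hL, hs] at h
  have key : ∀ K ⊆ L, 0 < #K → #K ≤ e →
      q ≤ 1 + (#(B 0) + #(B 0) / 2) + ∑ i ∈ K, (#(B i) - 1) → Covers B := by
    intro K hKL hK0 hKe hKf
    refine covers_of_subset B K (#(B 0) + #(B 0) / 2) (fun h => hL0 (hKL h)) (fun i hi => ?_)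
      (Finset.card_pos.1 hK0) ?_ ?_ hKf
    · exact (Finset.mem_filter.1 (hKL hi)).2
    · rwa [add_comm _ 1, ← add_assoc]
    · change p + 2 * #K ≤ 1 + N
      omega
  rcases le_or_gt e #M with h | h
  · obtain ⟨K, hKM, hKe⟩ := Finset.exists_subset_card_eq h
    refine key K (hKM.trans hML) (by omega) hKe.le ?_
    have : #K * 2 ≤ ∑ i ∈ K, (#(B i) - 1) := by
      rw [← smul_eq_mul]
      refine Finset.card_nsmul_le_sum _ _ _ fun i hi => ?_
      have := (Finset.mem_filter.1 (hKM hi)).2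
      omega
    omega
  rcases le_or_gt #L e with h' | h'
  · have h1 : ∑ i ∈ L, (#(B i) - 1) = ∑ i ∈ s, (#(B i) - 1) := sum_filter_tsub s _ 1
    have h2 : N ≤ ∑ i ∈ s, (#(B i) - 1) + 1 * #s := sum_le_sum_tsub_add_mul_card s _ 1
    refine key L subset_rfl (Finset.card_pos.2 ?_) h' (by omega)
    rw [Finset.nonempty_iff_ne_empty]
    intro h0
    rw [h0] at h1
    simp only [Finset.sum_empty] at h1
    omega
  · obtain ⟨K, hMK, hKL, hKe⟩ := Finset.exists_subsuperset_card_eq hML h.le h'.le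
    refine key K hKL (by omega) hKe.le ?_
    have h1 : ∑ i ∈ M, (#(B i) - 2) = ∑ i ∈ s, (#(B i) - 2) := sum_filter_tsub s _ 2
    have h2 : N ≤ ∑ i ∈ s, (#(B i) - 2) + 2 * #s := sum_le_sum_tsub_add_mul_card s _ 2
    have h3 : ∑ i ∈ M, (#(B i) - 2) ≤ ∑ i ∈ K, (#(B i) - 2) :=
      Finset.sum_le_sum_of_subset hMK
    have h4 : ∑ i ∈ K, (#(B i) - 2) + 1 * #K ≤ ∑ i ∈ K, (#(B i) - 1) := by
      rw [one_mul, Finset.card_eq_sum_ones, ← Finset.sum_add_distrib]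
      refine Finset.sum_le_sum fun i hi => ?_
      have := (Finset.mem_filter.1 (hKL hi)).2
      omega
    omega

/-- The chosen numbers of elements are `2` at `j`, `0` on `D`, and `1` on the other fibres with at
least two elements. -/
lemma covers_of_four_le (B : ZMod p → Finset (ZMod q)) (hB : 0 ∉ B 0) {j : ZMod p} (hj0 : j ≠ 0)
    (hj : 4 ≤ #(B j)) (D : Finset (ZMod p)) (hjD : j ∉ D) (hD : ∀ i ∈ D, #(B i) ≤ 2)
    (hcov : ∀ t : ZMod p → ℕ, t j = 2 → (∀ i ∈ D, t i = 0) → (∀ i ≠ j, t i ≤ 1) →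
      (∀ i ≠ 0, 2 * t i ≤ #(B i)) → (∀ c, ∃ k : ZMod p → ℕ,
        (∀ i ∈ univ.erase 0, t i ≤ k i ∧ k i ≤ #(B i) - t i) ∧
        ∑ i ∈ univ.erase 0, (k i : ZMod p) * i = c))
    (hfill : q + 2 + #D ≤ #(B 0) + ∑ i ∈ univ.erase 0, (#(B i) - 1) + #(B j)) :
    Covers B := by
  set t : ZMod p → ℕ := fun i => if i = j then 2 else if i ∈ D then 0 else
    if 1 < #(B i) then 1 else 0 with ht
  have ht1 : ∀ i ≠ 0, 2 * t i ≤ #(B i) := fun i _ => by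
    simp only [ht]
    split_ifs with h1 h2 h3
    · subst h1
      omega
    all_goals omega
  refine covers_of_fill B t #(B 0) ht1 ⟨j, hj0, by simp [ht]⟩ ?_ (hcov t (by simp [ht]) ?_ ?_ ht1) ?_
  · rw [add_comm]
    exact min_le_card_subsetSums _ hB
  · intro i hi
    have hij : i ≠ j := fun h => hjD (h ▸ hi)
    simp [ht, hi, hij]
  · intro i hi
    simp only [ht, if_neg hi]
    split_ifs <;> omega
  · have hjs : j ∈ univ.erase (0 : ZMod p) := by simpa using hj0
    have h1 : ∑ i ∈ univ.erase 0, (#(B i) - 1) + (#(B j) - 3) ≤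
        ∑ i ∈ univ.erase 0, t i * (#(B i) - t i) + #D := by
      have h2 : #(B j) - 3 = ∑ i ∈ univ.erase 0, if i = j then #(B j) - 3 else 0 := by
        rw [Finset.sum_ite_eq', if_pos hjs]
      have h3 : ∑ i ∈ univ.erase 0, (if i ∈ D then 1 else 0) ≤ #D := by
        rw [Finset.sum_ite_mem, Finset.card_eq_sum_ones]
        exact Finset.sum_le_sum_of_subset Finset.inter_subset_right
      refine le_trans ?_ (Nat.add_le_add_left h3 _)
      rw [h2, ← Finset.sum_add_distrib, ← Finset.sum_add_distrib]
      refine Finset.sum_le_sum fun i _ => ?_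
      simp only [ht]
      split_ifs with h4 h5 h6
      · exact absurd (h4 ▸ h5) hjD
      · subst h4
        omega
      · have := hD i h6
        omega
      all_goals omega
    omega

lemma sum_add_card_le (t : ZMod p → ℕ) {j : ZMod p} (hj0 : j ≠ 0) (hj : t j = 2)
    (ht : ∀ i ≠ j, t i ≤ 1) (D : Finset (ZMod p)) (h0 : 0 ∉ D) (hD : ∀ i ∈ D, t i = 0) :
    ∑ i ∈ univ.erase 0, t i + #D ≤ p := by
  have hp : 0 < p := (Fact.out : p.Prime).pos
  have hjs : j ∈ univ.erase (0 : ZMod p) := by simpa using hj0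
  have hDs : D ⊆ univ.erase 0 := fun i hi => by
    simpa using fun h : i = 0 => h0 (h ▸ hi)
  have h1 : #D = ∑ i ∈ univ.erase 0, if i ∈ D then 1 else 0 := by
    rw [Finset.sum_ite_mem, Finset.inter_eq_right.2 hDs, Finset.card_eq_sum_ones]
  have h2 : ∑ i ∈ univ.erase (0 : ZMod p), (1 + if i = j then 1 else 0) = p := by
    rw [Finset.sum_add_distrib, Finset.sum_ite_eq', if_pos hjs, ← Finset.card_eq_sum_ones,
      card_univ_erase_zero]
    omega
  rw [h1, ← Finset.sum_add_distrib]
  refine le_trans (Finset.sum_le_sum fun i _ => ?_) h2.le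
  by_cases hij : i = j
  · subst hij
    have : i ∉ D := fun h => by
      have := hD i h
      omega
    simp [this, hj]
  · have h3 := ht i hij
    rw [if_neg hij]
    split_ifs with h4
    · rw [hD i h4]
    · omega

lemma covers_of_le_four (B : ZMod p → Finset (ZMod q)) (hB : 0 ∉ B 0) (hq : q = 2 * p + 3)
    (hp : 5 ≤ p) (h0 : #(B 0) = 2) (hm : ∑ i ∈ univ.erase 0, #(B i) = 3 * p - 2)
    (h2 : ∀ i ≠ 0, 2 ≤ #(B i)) (h4 : ∀ i ≠ 0, #(B i) ≤ 4) {j : ZMod p} (hj0 : j ≠ 0)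
    (hj : #(B j) = 4) : Covers B := by
  have hcs : #(univ.erase (0 : ZMod p)) = p - 1 := card_univ_erase_zero
  have h1 : ∑ i ∈ univ.erase 0, (#(B i) - 1) + 1 * #(univ.erase (0 : ZMod p)) =
      ∑ i ∈ univ.erase 0, #(B i) :=
    sum_tsub_add_mul_card _ _ 1 fun i hi => by
      have := h2 i (Finset.ne_of_mem_erase hi)
      omega
  have hs2 : ∑ i ∈ univ.erase 0, (#(B i) - 2) + 2 * #(univ.erase (0 : ZMod p)) =
      ∑ i ∈ univ.erase 0, #(B i) :=
    sum_tsub_add_mul_card _ _ 2 fun i hi => h2 i (Finset.ne_of_mem_erase hi)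
  have key : ∀ j a b : ZMod p, j ≠ 0 → a ≠ 0 → b ≠ 0 → #(B j) = 4 → a ≠ j → b ≠ j → a ≠ b →
      a + b ≠ 0 → 2 < #(B a) → 2 < #(B b) → Covers B := by
    intro j a b hj0 ha0 hb0 hj haj hbj hab hab' ha hb
    refine covers_of_four_le B hB hj0 hj.ge ∅ (by simp) (by simp) (fun t htj _ ht1 ht => ?_) ?_
    · have h3 := sum_add_card_le t hj0 htj ht1 ∅ (by simp) (by simp)
      rw [Finset.card_empty] at h3
      have h5 := ht1 a haj
      have h6 := ht1 b hbj
      exact exists_multiplicities_erase_of_ne _ t ht (by omega) ha0 hb0 hab hab' (by omega)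
        (by omega)
    · rw [Finset.card_empty]
      omega
  set M := ((univ.erase (0 : ZMod p)).erase j).filter fun i => 2 < #(B i) with hM
  have hMm : ∀ i ∈ M, i ≠ 0 ∧ i ≠ j ∧ 2 < #(B i) := fun i hi => by
    simp only [hM, Finset.mem_filter, Finset.mem_erase, Finset.mem_univ, and_true] at hi
    tauto
  have hsumM : ∑ i ∈ M, (#(B i) - 2) = p - 2 := by
    have h3 : ∑ i ∈ M, (#(B i) - 2) = ∑ i ∈ (univ.erase (0 : ZMod p)).erase j, (#(B i) - 2) :=
      sum_filter_tsub _ _ 2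
    have h4 := Finset.add_sum_erase (univ.erase 0) (fun i => #(B i) - 2)
      (show j ∈ univ.erase (0 : ZMod p) by simpa using hj0)
    simp only [hj] at h4
    omega
  have hMle : ∑ i ∈ M, (#(B i) - 2) ≤ #M * 2 := by
    rw [← smul_eq_mul]
    refine Finset.sum_le_card_nsmul _ _ _ fun i hi => ?_
    have := h4 i (hMm i hi).1
    omega
  rcases le_or_gt 3 #M with h | h
  · obtain ⟨a, ha, b, hb, hab, hab'⟩ := exists_ne_add_ne_zero h
    have ha' := hMm a ha
    have hb' := hMm b hb
    exact key j a b hj0 ha'.1 hb'.1 hj ha'.2.1 hb'.2.1 hab hab' ha'.2.2 hb'.2.2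
  · obtain ⟨y, z, hyz, hMyz⟩ := Finset.card_eq_two.1 (by omega : #M = 2)
    have hy := hMm y (by simp [hMyz])
    have hz := hMm z (by simp [hMyz])
    by_cases h0 : y + z = 0
    · rw [hMyz, Finset.sum_pair hyz] at hsumM
      have hy4 := h4 y hy.1
      have hz4 := h4 z hz.1
      by_cases h5 : #(B y) = 4
      · refine key y j z hy.1 hj0 hz.1 h5 hy.2.1.symm hyz.symm hz.2.1.symm (fun h6 => ?_)
          (by omega) hz.2.2
        exact hy.2.1 (add_right_cancel (h0.trans h6.symm))
      · refine key z j y hz.1 hj0 hy.1 (by omega) hz.2.1.symm hyz hy.2.1.symm (fun h6 => ?_)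
          (by omega) hy.2.2
        rw [add_comm y z] at h0
        exact hz.2.1 (add_right_cancel (h0.trans h6.symm))
    · exact key j y z hj0 hy.1 hz.1 hj hy.2.1 hz.2.1 hyz h0 hy.2.2 hz.2.2

lemma covers_of_le_two (B : ZMod p → Finset (ZMod q)) (hB : 0 ∉ B 0) (hq : 11 ≤ q)
    (hpq : 2 * p + 3 ≤ q) (hp : 3 ≤ p) (hm : #(B 0) + ∑ i ∈ univ.erase 0, #(B i) = p + q - 3)
    (h2 : #(B 0) ≤ 2) : Covers B := by
  have hcs : #(univ.erase (0 : ZMod p)) = p - 1 := card_univ_erase_zero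
  by_cases hz : ∃ i ≠ 0, #(B i) = 0
  · obtain ⟨l, hl0, hl⟩ := hz
    have hls : l ∈ univ.erase (0 : ZMod p) := by simpa using hl0
    set L := (univ.erase (0 : ZMod p)).filter fun i => 1 < #(B i) with hL
    have hLm : ∀ i ∈ L, i ≠ 0 ∧ 1 < #(B i) := fun i hi => by
      simpa [hL] using hi
    have h1 : ∑ i ∈ L, (#(B i) - 1) = ∑ i ∈ univ.erase 0, (#(B i) - 1) := sum_filter_tsub _ _ 1
    have h3 : ∑ i ∈ (univ.erase (0 : ZMod p)).erase l, #(B i) ≤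
        ∑ i ∈ (univ.erase (0 : ZMod p)).erase l, (#(B i) - 1) +
          1 * #((univ.erase (0 : ZMod p)).erase l) := sum_le_sum_tsub_add_mul_card _ _ 1
    have h4 := Finset.add_sum_erase (univ.erase 0) (fun i => #(B i) - 1) hls
    have h5 := Finset.add_sum_erase (univ.erase 0) (fun i => #(B i)) hls
    simp only [hl] at h4 h5
    rw [Finset.card_erase_of_mem hls] at h3
    have hLc : #L ≤ #(univ.erase (0 : ZMod p)) := Finset.card_filter_le _ _
    refine covers_of_subset B L #(B 0) (fun h => (hLm 0 h).1 rfl) (fun i hi => (hLm i hi).2) ?_ ?_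
      (by omega) (by omega)
    · rw [Finset.nonempty_iff_ne_empty]
      intro h0
      rw [h0, Finset.sum_empty] at h1
      omega
    · rw [add_comm]
      exact min_le_card_subsetSums _ hB
  · have hpos : ∀ i ≠ 0, 1 ≤ #(B i) := fun i hi =>
      Nat.one_le_iff_ne_zero.2 fun h => hz ⟨i, hi, h⟩
    have h1 : ∑ i ∈ univ.erase 0, (#(B i) - 1) + 1 * #(univ.erase (0 : ZMod p)) =
        ∑ i ∈ univ.erase 0, #(B i) :=
      sum_tsub_add_mul_card _ _ 1 fun i hi => hpos i (Finset.ne_of_mem_erase hi)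
    obtain ⟨j, hj0, hj⟩ : ∃ j ≠ 0, 4 ≤ #(B j) := by
      by_contra! hcon
      have : ∑ i ∈ univ.erase 0, (#(B i) - 1) ≤ #(univ.erase (0 : ZMod p)) * 2 := by
        rw [← smul_eq_mul]
        refine Finset.sum_le_card_nsmul _ _ _ fun i hi => ?_
        have := hcon i (Finset.ne_of_mem_erase hi)
        omega
      omega
    by_cases hsingle : ∃ l ≠ 0, #(B l) = 1
    · obtain ⟨l, hl0, hl⟩ := hsingle
      refine covers_of_four_le B hB hj0 hj ∅ (by simp) (by simp) (fun t htj _ ht1 ht => ?_) ?_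
      · have h3 := sum_add_card_le t hj0 htj ht1 {l} (by simpa using hl0.symm) fun i hi => by
          have := ht l hl0
          rw [Finset.mem_singleton.1 hi]
          omega
        rw [Finset.card_singleton] at h3
        exact exists_multiplicities_erase _ t ht (by omega)
      · rw [Finset.card_empty]
        omega
    have htwo : ∀ i ≠ 0, 2 ≤ #(B i) := fun i hi => by
      have := hpos i hi
      have : #(B i) ≠ 1 := fun h => hsingle ⟨i, hi, h⟩
      omega
    by_cases hE : 2 * p + 2 + #(B 0) ≤ q
    · refine covers_of_four_le B hB hj0 hj ∅ (by simp) (by simp) (fun t htj _ ht1 ht => ?_) ?_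
      · have h3 := sum_add_card_le t hj0 htj ht1 ∅ (by simp) (by simp)
        rw [Finset.card_empty] at h3
        exact exists_multiplicities_erase _ t ht (by omega)
      · rw [Finset.card_empty]
        omega
    have hq' : q = 2 * p + 3 := by omega
    have hp4 : p ≠ 4 := by
      rintro rfl
      exact absurd (Fact.out : Nat.Prime 4) (by norm_num)
    by_cases h5 : ∃ j ≠ 0, 5 ≤ #(B j)
    · obtain ⟨j, hj0, hj⟩ := h5
      obtain ⟨l, hl0, hl⟩ : ∃ l ≠ 0, #(B l) = 2 := by
        by_contra! hcon
        have hjs : j ∈ univ.erase (0 : ZMod p) := by simpa using hj0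
        have h6 := Finset.add_sum_erase (univ.erase 0) (fun i => #(B i)) hjs
        have h7 : #((univ.erase (0 : ZMod p)).erase j) * 3 ≤
            ∑ i ∈ (univ.erase (0 : ZMod p)).erase j, #(B i) := by
          rw [← smul_eq_mul]
          refine Finset.card_nsmul_le_sum _ _ _ fun i hi => ?_
          have hi0 := Finset.ne_of_mem_erase (Finset.mem_of_mem_erase hi)
          have := htwo i hi0
          have := hcon i hi0
          omega
        rw [Finset.card_erase_of_mem hjs] at h7
        omega
      refine covers_of_four_le B hB hj0 (by omega) {l} ?_ (by simp [hl])
        (fun t htj hD ht1 ht => ?_) ?_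
      · rw [Finset.mem_singleton]
        rintro rfl
        omega
      · have h3 := sum_add_card_le t hj0 htj ht1 {l} (by simpa using hl0.symm) hD
        rw [Finset.card_singleton] at h3
        exact exists_multiplicities_erase _ t ht (by omega)
      · rw [Finset.card_singleton]
        omega
    · have hfour : ∀ i ≠ 0, #(B i) ≤ 4 := fun i hi => by
        by_contra! h
        exact h5 ⟨i, hi, h⟩
      exact covers_of_le_four B hB hq' (by omega) (by omega) (by omega) htwo hfour hj0
        (le_antisymm (hfour j hj0) hj)

/-- The sum of the sizes of the fibres guarantees that all subset sums occur, provided the fibre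
over `0` is not full. -/
theorem covers_of_sum_card (B : ZMod p → Finset (ZMod q)) (hB : 0 ∉ B 0)
    (hpq : 2 * p + 3 ≤ q) (hp : 3 ≤ p) (hm : ∑ i, #(B i) = p + q - 3) (h2 : #(B 0) ≤ q - 2) :
    Covers B := by
  have hprime : q.Prime := Fact.out
  have hodd : q % 2 = 1 := hprime.mod_two_eq_one_iff_ne_two.2 (by omega)
  have hq9 : q ≠ 9 := by
    rintro rfl
    exact absurd hprime (by norm_num)
  rw [← Finset.add_sum_erase _ _ (mem_univ (0 : ZMod p))] at hm
  rcases le_or_gt #(B 0) 2 with h | h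
  · exact covers_of_le_two B hB (by omega) hpq hp hm h
  rcases le_or_gt #(B 0) (q - 4) with h' | h'
  · exact covers_of_three_le B hB hodd hpq hp hm h h'
  · exact covers_of_card_zero_fibre B hB (by omega) (by omega)
      (exists_multiplicities_erase (fun i => #(B i)) (fun _ => 0) (by simp) (by simp; omega))

/-- If the fibre over `0` is full and two other nonempty fibres are not opposite, then all subset
sums occur. -/
theorem covers_of_full_zero_fibre (B : ZMod p → Finset (ZMod q)) (hB : 0 ∉ B 0)
    (hpq : 2 * p + 3 ≤ q) (hp : 3 ≤ p) (hm : p + q - 3 ≤ ∑ i, #(B i)) (h0 : #(B 0) = q - 1)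
    {a b : ZMod p} (ha : a ≠ 0) (hb : b ≠ 0) (hab : a ≠ b) (hab' : a + b ≠ 0)
    (hBa : (B a).Nonempty) (hBb : (B b).Nonempty) : Covers B := by
  have hq9 : q ≠ 9 := by
    rintro rfl
    exact absurd (Fact.out : Nat.Prime 9) (by norm_num)
  have hq10 : q ≠ 10 := by
    rintro rfl
    exact absurd (Fact.out : Nat.Prime 10) (by norm_num)
  rw [← Finset.add_sum_erase _ _ (mem_univ (0 : ZMod p))] at hm
  exact covers_of_card_zero_fibre B hB (by omega) (by omega)
    (exists_multiplicities_erase_of_ne (fun i => #(B i)) (fun _ => 0) (by simp)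
      (by simp; omega) ha hb hab hab' (by simpa using hBa) (by simpa using hBb))

end Covers

lemma nss_mono {G : Type*} [AddCommGroup G] [DecidableEq G] {A B : Finset G} (h : A ⊆ B) :
    nss A ⊆ nss B :=
  Finset.image_subset_image (Finset.erase_subset_erase _ (Finset.powerset_mono.2 h))

lemma nonempty_addEquiv_prod {G : Type*} [AddCommGroup G] [Fintype G] {p q : ℕ} [Fact p.Prime]
    [Fact q.Prime] (h : Fintype.card G = p * q) (hpq : p ≠ q) :
    Nonempty (G ≃+ ZMod p × ZMod q) := by
  have hco : p.Coprime q := (Nat.coprime_primes Fact.out Fact.out).2 hpq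
  have hcard : Nat.card G = p * q := by rw [Nat.card_eq_fintype_card, h]
  have hz : IsZGroup (Multiplicative G) := by
    refine IsZGroup.of_squarefree ?_
    change Squarefree (Nat.card G)
    rw [hcard, Nat.squarefree_mul hco]
    exact ⟨(Fact.out : p.Prime).prime.squarefree, (Fact.out : q.Prime).prime.squarefree⟩
  have hc : IsCyclic (Multiplicative G) := inferInstance
  have ha : IsAddCyclic G := isCyclic_multiplicative_iff.1 hc
  have e := zmodAddCyclicAddEquiv ha
  rw [hcard] at e
  exact ⟨e.symm.trans (ZMod.chineseRemainder hco).toAddEquiv⟩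

section Fibres

variable {G : Type*} [AddCommGroup G] [DecidableEq G] {p q : ℕ} [Fact p.Prime] [Fact q.Prime]

/-- The fibre of `A` over `i`, in the coordinates given by `e`. -/
def fibre (e : G ≃+ ZMod p × ZMod q) (A : Finset G) (i : ZMod p) : Finset (ZMod q) :=
  univ.filter fun x => e.symm (i, x) ∈ A

lemma mem_fibre {e : G ≃+ ZMod p × ZMod q} {A : Finset G} {i : ZMod p} {x : ZMod q} :
    x ∈ fibre e A i ↔ e.symm (i, x) ∈ A := by
  simp [fibre]

lemma snd_mem_fibre {e : G ≃+ ZMod p × ZMod q} {A : Finset G} {g : G} (hg : g ∈ A) :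
    (e g).2 ∈ fibre e A (e g).1 := by
  simpa [mem_fibre] using hg

lemma zero_notMem_fibre {e : G ≃+ ZMod p × ZMod q} {A : Finset G} (hA : 0 ∉ A) :
    0 ∉ fibre e A 0 := by
  rw [mem_fibre]
  change e.symm 0 ∉ A
  rwa [map_zero]

variable [Fintype G]

lemma sum_card_fibre (e : G ≃+ ZMod p × ZMod q) (A : Finset G) :
    ∑ i, #(fibre e A i) = #A := by
  simp only [fibre, Finset.card_filter]
  rw [← Fintype.sum_prod_type (f := fun y : ZMod p × ZMod q => if e.symm y ∈ A then 1 else 0),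
    ← Equiv.sum_comp e.toEquiv]
  simp

lemma nss_eq_univ_of_covers (e : G ≃+ ZMod p × ZMod q) (A : Finset G)
    (h : Covers (fibre e A)) : nss A = univ := by
  rw [Finset.eq_univ_iff_forall]
  intro g
  obtain ⟨T, hTA, ⟨i, x, hx⟩, hc, hd⟩ := h (e g).1 (e g).2
  refine Finset.mem_image.2 ⟨univ.filter fun y => (e y).2 ∈ T (e y).1, ?_, ?_⟩
  · rw [Finset.mem_erase, Finset.mem_powerset]
    refine ⟨Finset.nonempty_iff_ne_empty.1 ⟨e.symm (i, x), by simpa using hx⟩, fun y hy => ?_⟩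
    have := mem_fibre.1 (hTA _ (Finset.mem_filter.1 hy).2)
    simpa using this
  · apply e.injective
    have h1 : e (∑ y with (e y).2 ∈ T (e y).1, y) =
        ∑ i, ∑ x, if x ∈ T i then ((i, x) : ZMod p × ZMod q) else 0 := by
      rw [map_sum, Finset.sum_filter, ← Fintype.sum_prod_type
        (f := fun y : ZMod p × ZMod q => if y.2 ∈ T y.1 then y else 0), ← Equiv.sum_comp e.toEquiv]
      rfl
    change e (∑ y with (e y).2 ∈ T (e y).1, y) = e g
    rw [h1]
    have h2 : ∀ i, (∑ x, if x ∈ T i then ((i, x) : ZMod p × ZMod q) else 0) =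
        ((#(T i) : ZMod p) * i, ∑ x ∈ T i, x) := fun i => by
      rw [Finset.sum_ite_mem, Finset.univ_inter]
      refine Prod.ext ?_ ?_
      · rw [Prod.fst_sum]
        simp
      · rw [Prod.snd_sum]
    rw [Finset.sum_congr rfl fun i _ => h2 i]
    refine Prod.ext ?_ ?_
    · rw [Prod.fst_sum]
      exact hc
    · rw [Prod.snd_sum]
      exact hd

lemma exists_card_eq_nss_ne_univ (e : G ≃+ ZMod p × ZMod q) (hp : 2 ≤ p) (hpq : p - 2 ≤ q) :
    ∃ A : Finset G, 0 ∉ A ∧ #A = p + q - 3 ∧ nss A ≠ univ := by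
  have hp1 : 1 < p := (Fact.out : p.Prime).one_lt
  have hq1 : 1 < q := (Fact.out : q.Prime).one_lt
  obtain ⟨S, -, hS⟩ := Finset.exists_subset_card_eq
    (show p - 2 ≤ #(univ : Finset (ZMod q)) by rwa [Finset.card_univ, ZMod.card])
  set A : Finset G := univ.filter fun g =>
    ((e g).1 = 0 ∧ (e g).2 ≠ 0) ∨ ((e g).1 = 1 ∧ (e g).2 ∈ S) with hA
  refine ⟨A, by simp [hA], ?_, fun h => ?_⟩
  · have h1 : ∀ i, #(fibre e A i) = (if i = 0 then q - 1 else 0) + if i = 1 then p - 2 else 0 := by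
      intro i
      have h2 : fibre e A i = if i = 0 then univ.erase 0 else if i = 1 then S else ∅ := by
        ext x
        rw [mem_fibre]
        by_cases h0 : i = 0
        · simp [hA, h0]
        · by_cases h1 : i = 1
          · simp [hA, h1]
          · simp [hA, h0, h1]
      rw [h2]
      by_cases h0 : i = 0
      · simp [h0, Finset.card_erase_of_mem]
      · by_cases h1 : i = 1
        · simp [h1, hS]
        · simp [h0, h1]
    rw [← sum_card_fibre e, Finset.sum_congr rfl fun i _ => h1 i, Finset.sum_add_distrib]
    simp
    omega
  · have h1 : e.symm (-1, 0) ∈ nss A := h ▸ mem_univ _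
    obtain ⟨B, hB, hsum⟩ := Finset.mem_image.1 h1
    rw [Finset.mem_erase, Finset.mem_powerset] at hB
    have h2 : (e (∑ g ∈ B, g)).1 = (#(B.filter fun g => (e g).1 = 1) : ZMod p) := by
      rw [map_sum, Prod.fst_sum, Finset.card_filter, Nat.cast_sum]
      refine Finset.sum_congr rfl fun g hg => ?_
      rcases (Finset.mem_filter.1 (hB.2 hg)).2 with h3 | h3
      · simp [h3.1]
      · simp [h3.1]
    have h3 : #(B.filter fun g => (e g).1 = 1) ≤ #S := by
      refine Finset.card_le_card_of_injOn (fun g => (e g).2) ?_ ?_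
      · intro g hg
        have hg' := Finset.mem_filter.1 hg
        rcases (Finset.mem_filter.1 (hB.2 hg'.1)).2 with h3 | h3
        · exact absurd (h3.1.symm.trans hg'.2) zero_ne_one
        · exact h3.2
      · intro g hg g' hg' hgg
        have h3 := (Finset.mem_filter.1 hg).2
        have h4 := (Finset.mem_filter.1 hg').2
        exact e.injective (Prod.ext (h3.trans h4.symm) hgg)
    have h4 : e (∑ g ∈ B, g) = (-1, 0) := by
      rw [← e.apply_symm_apply (-1, 0), ← hsum]
      rfl
    rw [h4] at h2
    have h5 : ((#(B.filter fun g => (e g).1 = 1) + 1 : ℕ) : ZMod p) = 0 := by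
      push_cast
      rw [← h2]
      simp
    rw [ZMod.natCast_eq_zero_iff] at h5
    have := Nat.le_of_dvd (by omega) h5
    omega

lemma add_sub_two_le_cr (e : G ≃+ ZMod p × ZMod q) (hp : 2 ≤ p) (hpq : p - 2 ≤ q) :
    p + q - 2 ≤ cr G := by
  have hmem : cr G ∈ {ℓ : ℕ | 0 < ℓ ∧ ∀ A : Finset G, (0 : G) ∉ A → ℓ ≤ A.card →
      nss A = Finset.univ} := by
    refine Nat.sInf_mem ⟨Fintype.card G + 1, by omega, fun A _ hA => ?_⟩
    have := Finset.card_le_univ A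
    omega
  obtain ⟨A, hA0, hA, hns⟩ := exists_card_eq_nss_ne_univ e hp hpq
  by_contra! h
  exact hns (hmem.2 A hA0 (by omega))

lemma exists_addSubgroup_of_card (e : G ≃+ ZMod p × ZMod q) (hp : 3 ≤ p) (hpq : 2 * p + 3 ≤ q)
    (A : Finset G) (hA0 : 0 ∉ A) (hA : p + q - 3 ≤ #A) (hns : nss A ≠ univ) :
    ∃ (H : AddSubgroup G) (g : G), g ∉ H ∧ Nat.card H = q ∧ (H : Set G) \ {0} ⊆ (A : Set G) ∧
      (A : Set G) ⊆ (H : Set G) ∪ (fun h => g + h) '' (H : Set G) ∪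
        (fun h => -g + h) '' (H : Set G) := by
  have hB0 : 0 ∉ fibre e A 0 := zero_notMem_fibre hA0
  have hsub : fibre e A 0 ⊆ univ.erase 0 := fun x hx => by
    simpa using fun h : x = 0 => hB0 (h ▸ hx)
  have hce : #(univ.erase (0 : ZMod q)) = q - 1 := card_univ_erase_zero
  have hfull : #(fibre e A 0) = q - 1 := by
    refine le_antisymm ((Finset.card_le_card hsub).trans hce.le) ?_
    by_contra! h
    obtain ⟨A', hA'A, hA'⟩ := Finset.exists_subset_card_eq hA
    have hle : fibre e A' 0 ⊆ fibre e A 0 := fun x hx => mem_fibre.2 (hA'A (mem_fibre.1 hx))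
    have h1 := nss_eq_univ_of_covers e A' (covers_of_sum_card _ (fun h => hB0 (hle h)) hpq hp
      (by rw [sum_card_fibre, hA']) (by have := Finset.card_le_card hle; omega))
    exact hns (Finset.univ_subset_iff.1 (h1 ▸ nss_mono hA'A))
  have hB : fibre e A 0 = univ.erase 0 := Finset.eq_of_subset_of_card_le hsub (by omega)
  obtain ⟨a, ha0, x, hx⟩ : ∃ a ≠ 0, (fibre e A a).Nonempty := by
    by_contra! hcon
    have h1 := sum_card_fibre e A
    rw [← Finset.add_sum_erase _ _ (mem_univ (0 : ZMod p)), Finset.sum_eq_zero fun i hi => by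
      rw [hcon i (Finset.ne_of_mem_erase hi), Finset.card_empty]] at h1
    omega
  let π : G →+ ZMod p := (AddMonoidHom.fst (ZMod p) (ZMod q)).comp e.toAddMonoidHom
  have hπ : ∀ g, π g = (e g).1 := fun g => rfl
  have hga : π (e.symm (a, x)) = a := by simp [hπ]
  have hsurj : Function.Surjective π := fun i => ⟨e.symm (i, 0), by simp [hπ]⟩
  refine ⟨π.ker, e.symm (a, x), by rwa [AddMonoidHom.mem_ker, hga], ?_, ?_, ?_⟩
  · have h1 := π.ker.card_mul_index
    rw [AddSubgroup.index_ker, AddMonoidHom.range_eq_top.2 hsurj, Nat.card_congr e.toEquiv,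
      Nat.card_prod] at h1
    simp only [AddSubgroup.card_top, Nat.card_zmod] at h1
    rw [mul_comm] at h1
    exact Nat.eq_of_mul_eq_mul_left (by omega) h1
  · rintro h ⟨hh, hne⟩
    have hh1 : (e h).1 = 0 := hh
    have h2 : (e h).2 ∈ fibre e A 0 := by
      rw [hB, Finset.mem_erase]
      refine ⟨fun h3 => hne ?_, mem_univ _⟩
      exact e.injective ((Prod.ext hh1 h3 : e h = 0).trans (map_zero e).symm)
    rw [mem_fibre, ← hh1] at h2
    simpa using h2
  · intro y hy
    by_cases h0 : π y = 0
    · exact Or.inl (Or.inl h0)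
    by_cases h1 : a = π y
    · refine Or.inl (Or.inr ⟨y - e.symm (a, x), ?_, by simp⟩)
      rw [SetLike.mem_coe, AddMonoidHom.mem_ker, map_sub, hga, h1, sub_self]
    by_cases h2 : a + π y = 0
    · refine Or.inr ⟨y + e.symm (a, x), ?_, by simp⟩
      rw [SetLike.mem_coe, AddMonoidHom.mem_ker, map_add, hga, add_comm, h2]
    · refine absurd (nss_eq_univ_of_covers e A (covers_of_full_zero_fibre _ hB0 hpq hp
        (by rwa [sum_card_fibre]) hfull ha0 h0 h1 h2 ⟨x, hx⟩ ⟨_, snd_mem_fibre hy⟩)) hns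

end Fibres

theorem stmt1 {G : Type*} [AddCommGroup G] [Fintype G] [DecidableEq G]
    (hp3 : 3 ≤ (Fintype.card G).minFac)
    (hqprime : (Fintype.card G / (Fintype.card G).minFac).Prime)
    (hqbig : 2 * (Fintype.card G).minFac + 3 ≤ Fintype.card G / (Fintype.card G).minFac)
    (A : Finset G) (hA0 : (0 : G) ∉ A) (hcard : A.card = cr G - 1)
    (hns : nss A ≠ Finset.univ) :
    ∃ (H : AddSubgroup G) (g : G), g ∉ H ∧
      Nat.card H = Fintype.card G / (Fintype.card G).minFac ∧
      (H : Set G) \ {0} ⊆ (A : Set G) ∧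
      (A : Set G) ⊆ (H : Set G) ∪ (fun h => g + h) '' (H : Set G) ∪
        (fun h => -g + h) '' (H : Set G) := by
  have hn : Fintype.card G ≠ 1 := fun h => by
    rw [h, Nat.minFac_one] at hp3
    omega
  have : Fact (Fintype.card G).minFac.Prime := ⟨Nat.minFac_prime hn⟩
  have : Fact (Fintype.card G / (Fintype.card G).minFac).Prime := ⟨hqprime⟩
  obtain ⟨e⟩ := nonempty_addEquiv_prod (G := G)
    (Nat.mul_div_cancel' (Nat.minFac_dvd (Fintype.card G))).symm (by omega)
  have hcr := add_sub_two_le_cr e (by omega) (by omega)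
  exact exists_addSubgroup_of_card e hp3 hqbig A hA0 (by omega) hns
end
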